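/- Fix x ∈ ℝ and E ∈ ℝ, assume the Lyapunov exponent L(E) exists, is finite and positive, and that 0 < β(α) < ∞, where β = β(α). Fix t₂ with (9β − L(E))/(9β) < t₂ < 1 and σ > 0 small enough that t₁ := (β − L(E))/β + σ < t₂. Suppose E admits a generalized eigenfunction. Then for every ε > 0 there exists L₀ > 0 such that for every L ≥ L₀ one has both ω₊(L) ≥ L^{1 + L(E)/(2 t₁ β) − ε} and ω₋(L) ≥ L^{1 + L(E)/(2 t₁ β) − ε}. -/

import Mathlib

open scoped Real
open Filter

/-- The restriction `H_I` of the discrete Schrödinger operator with potential `V`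
to the integer interval `I = [n₁, n₂]`, as a finite tridiagonal matrix. -/
noncomputable def schrodingerRestriction (V : ℤ → ℝ) (n₁ n₂ : ℤ) :
    Matrix (Finset.Icc n₁ n₂) (Finset.Icc n₁ n₂) ℝ :=
  fun i j =>
    if (i : ℤ) = (j : ℤ) then V (i : ℤ)
    else if (i : ℤ) = (j : ℤ) + 1 ∨ (j : ℤ) = (i : ℤ) + 1 then 1 else 0

/-- `m` is `(t, k)`-regular with witnessing interval `[n₁, n₂]`:
`n₂ - n₁ = k - 1`, `m ∈ [n₁, n₂]`, `m - n₁ ≥ k/2`, `n₂ - m ≥ k/2`, `H_I - E` is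
invertible and the Green's function satisfies `|G_I(m, nᵢ)| ≤ e^{-t |m - nᵢ|}`. -/
def RegularOn (V : ℤ → ℝ) (E t : ℝ) (k : ℕ) (m n₁ n₂ : ℤ) : Prop :=
  n₂ - n₁ = (k : ℤ) - 1 ∧ n₁ ≤ m ∧ m ≤ n₂ ∧
  (k : ℝ) / 2 ≤ ((m - n₁ : ℤ) : ℝ) ∧ (k : ℝ) / 2 ≤ ((n₂ - m : ℤ) : ℝ) ∧
  (schrodingerRestriction V n₁ n₂ - E • (1 : Matrix _ _ ℝ)).det ≠ 0 ∧
  ∀ (hm : m ∈ Finset.Icc n₁ n₂) (h1 : n₁ ∈ Finset.Icc n₁ n₂) (h2 : n₂ ∈ Finset.Icc n₁ n₂),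
    |((schrodingerRestriction V n₁ n₂ - E • (1 : Matrix _ _ ℝ))⁻¹ :
        Matrix (Finset.Icc n₁ n₂) (Finset.Icc n₁ n₂) ℝ) ⟨m, hm⟩ ⟨n₁, h1⟩|
        ≤ Real.exp (-t * |((m - n₁ : ℤ) : ℝ)|) ∧
    |((schrodingerRestriction V n₁ n₂ - E • (1 : Matrix _ _ ℝ))⁻¹ :
        Matrix (Finset.Icc n₁ n₂) (Finset.Icc n₁ n₂) ℝ) ⟨m, hm⟩ ⟨n₂, h2⟩|
        ≤ Real.exp (-t * |((m - n₂ : ℤ) : ℝ)|)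

/-- `m` is `(t, k)`-regular. -/
def RegularPt (V : ℤ → ℝ) (E t : ℝ) (k : ℕ) (m : ℤ) : Prop :=
  ∃ n₁ n₂ : ℤ, RegularOn V E t k m n₁ n₂

/-- `u` solves the eigenvalue equation `u(n+1) + u(n-1) + V(n) u(n) = E u(n)`. -/
def IsSolution (V : ℤ → ℝ) (E : ℝ) (u : ℤ → ℝ) : Prop :=
  ∀ n : ℤ, u (n + 1) + u (n - 1) + V n * u n = E * u n

/-- A generalized eigenfunction: a normalized, linearly bounded solution. -/
def IsGeneralizedEigenfunction (V : ℤ → ℝ) (E : ℝ) (u : ℤ → ℝ) : Prop :=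
  IsSolution V E u ∧ (u 0) ^ 2 + (u 1) ^ 2 = 1 ∧
  ∃ C : ℝ, 0 < C ∧ ∀ n : ℤ, |u n| ≤ C * (1 + |(n : ℝ)|)

/-- `(u(n), u(n+1))` for `n ≥ 0`, generated by the eigenvalue equation from
initial data `u(0) = a`, `u(1) = b`. -/
noncomputable def solSeqPos (V : ℤ → ℝ) (E a b : ℝ) : ℕ → ℝ × ℝ
  | 0 => (a, b)
  | n + 1 =>
    ((solSeqPos V E a b n).2,
      (E - V ((n : ℤ) + 1)) * (solSeqPos V E a b n).2 - (solSeqPos V E a b n).1)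

/-- `(u(-n), u(-n+1))` for `n ≥ 0`, generated by the eigenvalue equation from
initial data `u(0) = a`, `u(1) = b`. -/
noncomputable def solSeqNeg (V : ℤ → ℝ) (E a b : ℝ) : ℕ → ℝ × ℝ
  | 0 => (a, b)
  | n + 1 =>
    ((E - V (-(n : ℤ))) * (solSeqNeg V E a b n).1 - (solSeqNeg V E a b n).2,
      (solSeqNeg V E a b n).1)

/-- The unique solution of the eigenvalue equation with `u(0) = a`, `u(1) = b`. -/
noncomputable def solFun (V : ℤ → ℝ) (E a b : ℝ) (m : ℤ) : ℝ :=
  if 0 ≤ m then (solSeqPos V E a b m.toNat).1 else (solSeqNeg V E a b (-m).toNat).1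

/-- The solution `u_θ` with `u_θ(0) = -sin θ`, `u_θ(1) = cos θ`. -/
noncomputable def uTheta (V : ℤ → ℝ) (E θ : ℝ) : ℤ → ℝ :=
  solFun V E (-Real.sin θ) (Real.cos θ)

/-- The truncated norm `‖u‖_L⁺`. -/
noncomputable def normPlus (u : ℤ → ℝ) (L : ℝ) : ℝ :=
  Real.sqrt ((∑ n ∈ Finset.Icc (1 : ℤ) ⌊L⌋, (u n) ^ 2) +
    (L - ⌊L⌋) * (u (⌊L⌋ + 1)) ^ 2)

/-- The truncated norm `‖u‖_L⁻`. -/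
noncomputable def normMinus (u : ℤ → ℝ) (L : ℝ) : ℝ :=
  Real.sqrt ((∑ n ∈ Finset.Icc (0 : ℤ) ⌊L⌋, (u (-n)) ^ 2) +
    (L - ⌊L⌋) * (u (-⌊L⌋ - 1)) ^ 2)

/-- `ω₊(L) = max_θ ‖u_θ‖_L⁺ ⋅ min_θ ‖u_θ‖_L⁺`. -/
noncomputable def omegaPlus (V : ℤ → ℝ) (E L : ℝ) : ℝ :=
  sSup ((fun θ => normPlus (uTheta V E θ) L) '' Set.Ico 0 π) *
    sInf ((fun θ => normPlus (uTheta V E θ) L) '' Set.Ico 0 π)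

/-- `ω₋(L) = max_θ ‖u_θ‖_L⁻ ⋅ min_θ ‖u_θ‖_L⁻`. -/
noncomputable def omegaMinus (V : ℤ → ℝ) (E L : ℝ) : ℝ :=
  sSup ((fun θ => normMinus (uTheta V E θ) L) '' Set.Ico 0 π) *
    sInf ((fun θ => normMinus (uTheta V E θ) L) '' Set.Ico 0 π)

/-- The transfer matrix `T_j(x,E)` for the potential `n ↦ f(x + nα)`. -/
noncomputable def transferT (f : ℝ → ℝ) (α x E : ℝ) (j : ℤ) : Matrix (Fin 2) (Fin 2) ℝ :=
  !![E - f (x + j * α), -1; 1, 0]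

/-- The `n`-step transfer matrix `Φ_n(x,E) = T_n ⋯ T_1`. -/
noncomputable def transferPhi (f : ℝ → ℝ) (α x E : ℝ) : ℕ → Matrix (Fin 2) (Fin 2) ℝ
  | 0 => 1
  | n + 1 => transferT f α x E ((n : ℤ) + 1) * transferPhi f α x E n

/-- A norm on `2 × 2` real matrices. -/
noncomputable def matNorm (M : Matrix (Fin 2) (Fin 2) ℝ) : ℝ :=
  Real.sqrt (∑ i, ∑ j, (M i j) ^ 2)

/-- The statement that the Lyapunov exponent
`L(E) = lim_n (1/n) ∫₀¹ log ‖Φ_n(x,E)‖ dx` exists and equals `LE`. -/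
def LyapunovAt (f : ℝ → ℝ) (α E LE : ℝ) : Prop :=
  Filter.Tendsto
    (fun n : ℕ => (1 / (n : ℝ)) * ∫ y in (0 : ℝ)..(1 : ℝ),
      Real.log (matNorm (transferPhi f α y E n)))
    Filter.atTop (nhds LE)

/-- `f` is 1-periodic and `γ`-monotone, with `∫₀¹ log(1+|f|) < ∞`. -/
def MonotonePotential (f : ℝ → ℝ) (γ : ℝ) : Prop :=
  0 < γ ∧ (∀ y : ℝ, f (y + 1) = f y) ∧
  (∀ a b : ℝ, 0 ≤ a → a < b → b < 1 → γ * (b - a) ≤ f b - f a) ∧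
  MeasureTheory.IntegrableOn (fun y => Real.log (1 + |f y|)) (Set.Ioo 0 1)

/-- `q` is the sequence of denominators of the continued fraction convergents of `α`. -/
def IsCFDenomSeq (α : ℝ) (q : ℕ → ℕ) : Prop :=
  ∀ n : ℕ, (q n : ℝ) = (GenContFract.of α).dens n

/-- `β(α) = limsup_n (ln q_{n+1}) / q_n`. -/
noncomputable def cfBeta (q : ℕ → ℕ) : ℝ :=
  Filter.limsup (fun n : ℕ => Real.log (q (n + 1)) / (q n : ℝ)) Filter.atTop

/-- `k` is `n`-resonant (w.r.t. the parameter `τ`): `k ∈ ⋃_l [l qₙ - bₙ, l qₙ + bₙ]`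
with `bₙ = ⌊τ qₙ⌋`. -/
def Resonant (q : ℕ → ℕ) (τ : ℝ) (n : ℕ) (k : ℤ) : Prop :=
  ∃ l : ℤ, l * (q n : ℤ) - ⌊τ * (q n : ℝ)⌋ ≤ k ∧ k ≤ l * (q n : ℤ) + ⌊τ * (q n : ℝ)⌋

/-- `r_l^u = max_{x ∈ R_l} |u(x)|` where `R_l = [l qₙ - bₙ, l qₙ + bₙ]`. -/
noncomputable def resMax (q : ℕ → ℕ) (τ : ℝ) (n : ℕ) (l : ℤ) (u : ℤ → ℝ) : ℝ :=
  sSup ((fun m : ℤ => |u m|) ''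
    {m : ℤ | l * (q n : ℤ) - ⌊τ * (q n : ℝ)⌋ ≤ m ∧ m ≤ l * (q n : ℤ) + ⌊τ * (q n : ℝ)⌋})

/-- The continuant of `v 0, …, v (n - 1)`: the determinant of the tridiagonal matrix with this
diagonal and off-diagonal entries `-1`. -/
def continuant {R : Type*} [CommRing R] (v : ℕ → R) : ℕ → R
  | 0 => 1
  | 1 => v 0
  | n + 2 => v (n + 1) * continuant v (n + 1) - continuant v n

section Continuant

variable {R : Type*} [CommRing R]

theorem continuant_succ_succ_left (v : ℕ → R) (n : ℕ) :
    continuant v (n + 2) =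
      v 0 * continuant (fun i => v (i + 1)) (n + 1) - continuant (fun i => v (i + 2)) n := by
  induction n using Nat.twoStepInduction with
  | zero => simp [continuant]; ring
  | one => simp [continuant]; ring
  | more n ih₁ ih₂ =>
    have h1 : continuant v (n + 2 + 2) =
      v (n + 3) * continuant v (n + 1 + 2) - continuant v (n + 2) := rfl
    have h2 : continuant (fun i => v (i + 1)) (n + 2 + 1) = v (n + 3) *
      continuant (fun i => v (i + 1)) (n + 1 + 1) - continuant (fun i => v (i + 1)) (n + 1) := rfl
    have h3 : continuant (fun i => v (i + 2)) (n + 2) = v (n + 3) *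
      continuant (fun i => v (i + 2)) (n + 1) - continuant (fun i => v (i + 2)) n := rfl
    rw [h1, h2, h3, ih₁, ih₂]
    ring

theorem map_continuant {S : Type*} [CommRing S] (φ : R →+* S) (v : ℕ → R) (n : ℕ) :
    φ (continuant v n) = continuant (fun i => φ (v i)) n := by
  induction n using Nat.twoStepInduction with
  | zero => simp [continuant]
  | one => simp [continuant]
  | more n ih₁ ih₂ => simp [continuant, ih₁, ih₂]

/-- Duhamel's formula for a constant shift of all the arguments of a continuant. -/
theorem continuant_add_const (v : ℕ → R) (z : R) (n : ℕ) :
    continuant (fun i => v i + z) n = continuant v n +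
      z * ∑ i ∈ Finset.range n, continuant (fun j => v j + z) i *
        continuant (fun j => v (i + 1 + j)) (n - 1 - i) := by
  induction n using Nat.twoStepInduction with
  | zero => simp [continuant]
  | one => simp [continuant]
  | more n ih₁ ih₂ =>
    have e : ∀ i ∈ Finset.range n, continuant (fun j => v (i + 1 + j)) (n + 2 - 1 - i) =
        v (n + 1) * continuant (fun j => v (i + 1 + j)) (n + 1 - 1 - i) -
          continuant (fun j => v (i + 1 + j)) (n - 1 - i) := by
      intro i hi
      have hi := Finset.mem_range.1 hi
      obtain ⟨m, rfl⟩ := Nat.exists_eq_add_of_lt hi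
      rw [show i + m + 1 + 2 - 1 - i = m + 2 by omega, show i + m + 1 + 1 - 1 - i = m + 1 by omega,
        show i + m + 1 - 1 - i = m by omega, continuant]
      ring_nf
    rw [Finset.sum_range_succ, Finset.sum_range_succ,
      Finset.sum_congr rfl fun i hi => congrArg _ (e i hi)]
    rw [Finset.sum_range_succ] at ih₂
    rw [continuant, continuant.eq_3 v]
    have h1 : n + 2 - 1 - n = 1 := by omega
    have h2 : n + 2 - 1 - (n + 1) = 0 := by omega
    have h3 : n + 1 - 1 - n = 0 := by omega
    rw [h1, h2]
    rw [h3] at ih₂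
    simp only [continuant, mul_one, add_zero, mul_sub, Finset.sum_sub_distrib] at ih₂ ⊢
    have e2 : ∑ i ∈ Finset.range n, continuant (fun j => v j + z) i *
        (v (n + 1) * continuant (fun j => v (i + 1 + j)) (n + 1 - 1 - i)) =
        v (n + 1) * ∑ i ∈ Finset.range n, continuant (fun j => v j + z) i *
          continuant (fun j => v (i + 1 + j)) (n + 1 - 1 - i) := by
      rw [Finset.mul_sum]; exact Finset.sum_congr rfl fun i _ => by ring
    rw [e2]
    linear_combination v (n + 1) * ih₂ - ih₁

end Continuant

theorem norm_continuant_add_const_le (v : ℕ → ℂ) (z : ℂ) (B : ℝ) (n : ℕ)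
    (hB : ∀ i m, i + m ≤ n → ‖continuant (fun j => v (i + j)) m‖ ≤ B) :
    ‖continuant (fun i => v i + z) n‖ ≤ B * (1 + ‖z‖ * B) ^ n := by
  have hB0 : 0 ≤ B := (norm_nonneg _).trans (hB 0 0 (by omega))
  induction n using Nat.strong_induction_on with
  | _ n ih =>
    rw [continuant_add_const]
    have h0 : ‖continuant v n‖ ≤ B := by simpa using hB 0 n (by omega)
    have hsum : ‖∑ i ∈ Finset.range n, continuant (fun j => v j + z) i *
        continuant (fun j => v (i + 1 + j)) (n - 1 - i)‖ ≤
        ∑ i ∈ Finset.range n, B * (1 + ‖z‖ * B) ^ i * B := by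
      refine (norm_sum_le _ _).trans (Finset.sum_le_sum fun i hi => ?_)
      have hi := Finset.mem_range.1 hi
      rw [norm_mul]
      refine mul_le_mul (ih i hi fun a m ham => hB a m (by omega)) (hB _ _ (by omega))
        (norm_nonneg _) (by positivity)
    have hgeom : ‖z‖ * ∑ i ∈ Finset.range n, B * (1 + ‖z‖ * B) ^ i * B =
        B * ((1 + ‖z‖ * B) ^ n - 1) := by
      have := geom_sum_mul (1 + ‖z‖ * B) n
      rw [← this, ← Finset.sum_mul, ← Finset.mul_sum]; ring
    calc _ ≤ ‖continuant v n‖ + ‖z‖ * ‖∑ i ∈ Finset.range n, continuant (fun j => v j + z) i *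
        continuant (fun j => v (i + 1 + j)) (n - 1 - i)‖ := by
          rw [← norm_mul]; exact norm_add_le _ _
      _ ≤ B + B * ((1 + ‖z‖ * B) ^ n - 1) := by
          rw [← hgeom]; gcongr
      _ = _ := by ring

theorem mul_norm_le_of_mul_sq_le_im {η : ℝ} {a b : ℂ}
    (h : η * ‖b‖ ^ 2 ≤ (a * (starRingEnd ℂ) b).im) : η * ‖b‖ ≤ ‖a‖ := by
  rcases eq_or_ne b 0 with rfl | hb
  · simp
  · have h1 : (a * (starRingEnd ℂ) b).im ≤ ‖a‖ * ‖b‖ := by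
      refine (Complex.im_le_norm _).trans ?_
      rw [norm_mul, RCLike.norm_conj]
    have hb' : 0 < ‖b‖ := norm_pos_iff.2 hb
    nlinarith

theorem mul_norm_continuant_le_succ {v : ℕ → ℂ} {η : ℝ} (hη : 0 ≤ η) (hv : ∀ i, η ≤ (v i).im)
    (n : ℕ) : η * ‖continuant v n‖ ≤ ‖continuant v (n + 1)‖ := by
  refine mul_norm_le_of_mul_sq_le_im ?_
  induction n with
  | zero => simpa [continuant] using hv 0
  | succ n ih =>
    have : (continuant v (n + 2) * (starRingEnd ℂ) (continuant v (n + 1))).im =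
        (v (n + 1)).im * ‖continuant v (n + 1)‖ ^ 2 +
          (continuant v (n + 1) * (starRingEnd ℂ) (continuant v n)).im := by
      rw [continuant, ← Complex.normSq_eq_norm_sq, Complex.normSq_apply]
      simp; ring
    rw [this]
    have h1 : 0 ≤ η * ‖continuant v n‖ ^ 2 := by positivity
    have h2 := mul_le_mul_of_nonneg_right (hv (n + 1)) (sq_nonneg ‖continuant v (n + 1)‖)
    linarith

theorem mul_norm_continuant_tail_le {v : ℕ → ℂ} {η : ℝ} (hη : 0 ≤ η) (hv : ∀ i, η ≤ (v i).im)
    (n : ℕ) : η * ‖continuant (fun i => v (i + 1)) n‖ ≤ ‖continuant v (n + 1)‖ := by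
  refine mul_norm_le_of_mul_sq_le_im ?_
  induction n generalizing v with
  | zero => simpa [continuant] using hv 0
  | succ n ih =>
    have : (continuant v (n + 2) *
        (starRingEnd ℂ) (continuant (fun i => v (i + 1)) (n + 1))).im =
        (v 0).im * ‖continuant (fun i => v (i + 1)) (n + 1)‖ ^ 2 +
          (continuant (fun i => v (i + 1)) (n + 1) *
            (starRingEnd ℂ) (continuant (fun i => v (i + 2)) n)).im := by
      rw [continuant_succ_succ_left, ← Complex.normSq_eq_norm_sq, Complex.normSq_apply]
      simp; ring
    rw [this]
    have h1 : 0 ≤ η * ‖continuant (fun i => v (i + 2)) n‖ ^ 2 := by positivity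
    have h2 := mul_le_mul_of_nonneg_right (hv 0)
      (sq_nonneg ‖continuant (fun i => v (i + 1)) (n + 1)‖)
    have h3 := ih (v := fun i => v (i + 1)) fun i => hv (i + 1)
    linarith

theorem transferPhi_eq_continuant (f : ℝ → ℝ) (α y E : ℝ) (n : ℕ) :
    transferPhi f α y E (n + 2) =
      !![continuant (fun i : ℕ => E - f (y + (i + 1) * α)) (n + 2),
          -continuant (fun i : ℕ => E - f (y + (i + 2) * α)) (n + 1);
        continuant (fun i : ℕ => E - f (y + (i + 1) * α)) (n + 1),
          -continuant (fun i : ℕ => E - f (y + (i + 2) * α)) n] := by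
  induction n with
  | zero =>
    ext i j
    fin_cases i <;> fin_cases j <;>
      simp [transferPhi, transferT, continuant, Matrix.mul_apply, Fin.sum_univ_two]
    · ring_nf
  | succ n ih =>
    rw [transferPhi, ih]
    have h1 : ∀ u : ℕ → ℝ, continuant u (n + 1 + 2) =
      u (n + 2) * continuant u (n + 2) - continuant u (n + 1) := fun u => rfl
    have h2 : ∀ u : ℕ → ℝ, continuant u (n + 1 + 1) =
      u (n + 1) * continuant u (n + 1) - continuant u n := fun u => rfl
    ext i j
    fin_cases i <;> fin_cases j <;>
      simp [transferT, Matrix.mul_apply, Fin.sum_univ_two, h1, h2]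
    · ring
    · ring_nf

/-- The tridiagonal matrix with diagonal `v 0, …, v (k - 1)` and off-diagonal entries `c`. -/
def tridiagonal {R : Type*} [CommRing R] (c : R) (v : ℕ → R) (k : ℕ) :
    Matrix (Fin k) (Fin k) R :=
  Matrix.of fun i j =>
    if (i : ℕ) = j then v i else if (i : ℕ) + 1 = j ∨ (j : ℕ) + 1 = i then c else 0

theorem det_tridiagonal_neg_one {R : Type*} [CommRing R] (v : ℕ → R) (k : ℕ) :
    (tridiagonal (-1) v k).det = continuant v k := by
  induction k using Nat.twoStepInduction generalizing v with
  | zero => simp [continuant]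
  | one => simp [continuant, tridiagonal]
  | more n ih₁ ih₂ =>
    rw [continuant_succ_succ_left, ← ih₁, ← ih₂, Matrix.det_succ_row_zero, Fin.sum_univ_succ,
      Fin.sum_univ_succ]
    have h0 : (tridiagonal (-1) v (n + 2)).submatrix Fin.succ (Fin.succAbove 0) =
        tridiagonal (-1) (fun i => v (i + 1)) (n + 1) := by
      ext i j
      simp [tridiagonal]
    have h1 : ((tridiagonal (-1) v (n + 2)).submatrix Fin.succ
        (Fin.succAbove (Fin.succ 0))).det =
        -(tridiagonal (-1) (fun i => v (i + 2)) n).det := by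
      rw [Matrix.det_succ_column_zero, Fin.sum_univ_succ, Finset.sum_eq_zero]
      · have : (((tridiagonal (-1) v (n + 2)).submatrix Fin.succ
            (Fin.succAbove (Fin.succ 0))).submatrix (Fin.succAbove 0) Fin.succ) =
            tridiagonal (-1) (fun i => v (i + 2)) n := by
          ext i j
          simp [tridiagonal]
        rw [this]
        simp [tridiagonal]
      · intro i _
        simp [tridiagonal]
    rw [h0, h1, Finset.sum_eq_zero]
    · simp [tridiagonal]
      ring
    · intro i _
      simp [tridiagonal]

theorem isHermitian_tridiagonal (v : ℕ → ℝ) (k : ℕ) : (tridiagonal 1 v k).IsHermitian := by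
  ext i j
  simp only [tridiagonal, Matrix.conjTranspose_apply, Matrix.of_apply, star_trivial]
  by_cases h : (i : ℕ) = j
  · simp [h]
  · simp [h, Ne.symm h, or_comm]

/-- The eigenvalues, in decreasing order, of the tridiagonal matrix with diagonal
`v 0, …, v (k - 1)` and unit off-diagonal entries. -/
noncomputable def jacobiEigenvalue (v : ℕ → ℝ) (k : ℕ) (i : Fin k) : ℝ :=
  (isHermitian_tridiagonal v k).eigenvalues₀ (Fin.cast (Fintype.card_fin k).symm i)

theorem continuant_eq_prod_jacobiEigenvalue (v : ℕ → ℝ) (k : ℕ) (z : ℂ) :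
    continuant (fun i => z - v i) k = ∏ i, (z - jacobiEigenvalue v k i) := by
  have hH := isHermitian_tridiagonal v k
  have h1 : ((tridiagonal 1 v k).map (algebraMap ℝ ℂ)).charpoly.eval z =
      ∏ i, (z - hH.eigenvalues i) := by
    rw [Matrix.charpoly_map, hH.charpoly_eq, Polynomial.map_prod, Polynomial.eval_prod]
    simp
  have h2 : Matrix.scalar (Fin k) z - (tridiagonal 1 v k).map (algebraMap ℝ ℂ) =
      tridiagonal (-1) (fun i => z - v i) k := by
    ext i j
    by_cases h : i = j
    · subst h; simp [tridiagonal]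
    · have h' : (i : ℕ) ≠ j := fun h'' => h (Fin.ext h'')
      simp only [tridiagonal, Matrix.sub_apply, Matrix.map_apply, Matrix.of_apply, h', if_false,
        Matrix.scalar_apply, Matrix.diagonal_apply_ne _ h]
      split_ifs <;> simp
  rw [Matrix.eval_charpoly, h2, det_tridiagonal_neg_one] at h1
  rw [h1]
  refine Fintype.prod_equiv ((Fintype.equivOfCardEq (Fintype.card_fin _)).symm.trans
    (finCongr (Fintype.card_fin k))) _ _ fun i => ?_
  simp [jacobiEigenvalue, Matrix.IsHermitian.eigenvalues]

section MinMax

variable {E F : Type*} [NormedAddCommGroup E] [InnerProductSpace ℝ E] [FiniteDimensional ℝ E]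
  [AddCommGroup F] [Module ℝ F] [FiniteDimensional ℝ F]

theorem inner_apply_self_eq_sum_eigenvalues {T : E →ₗ[ℝ] E} (hT : T.IsSymmetric) {n : ℕ}
    (hn : Module.finrank ℝ E = n) (u : E) :
    inner ℝ (T u) u =
      ∑ i, hT.eigenvalues hn i * inner ℝ (hT.eigenvectorBasis hn i) u ^ 2 := by
  rw [← OrthonormalBasis.sum_inner_mul_inner (hT.eigenvectorBasis hn) (T u) u]
  refine Finset.sum_congr rfl fun i _ => ?_
  rw [hT u, hT.apply_eigenvectorBasis, inner_smul_right, real_inner_comm]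
  simp; ring

theorem norm_sq_eq_sum_inner_eigenvectorBasis {T : E →ₗ[ℝ] E} (hT : T.IsSymmetric) {n : ℕ}
    (hn : Module.finrank ℝ E = n) (u : E) :
    ‖u‖ ^ 2 = ∑ i, inner ℝ (hT.eigenvectorBasis hn i) u ^ 2 := by
  rw [← real_inner_self_eq_norm_sq,
    ← OrthonormalBasis.sum_inner_mul_inner (hT.eigenvectorBasis hn) u u]
  exact Finset.sum_congr rfl fun i _ => by rw [real_inner_comm]; ring

theorem exists_eigenvalues_mul_norm_sq_le {T : E →ₗ[ℝ] E} (hT : T.IsSymmetric) {n : ℕ}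
    (hn : Module.finrank ℝ E = n) (r : Fin n) (L : E →ₗ[ℝ] F) (hL : Module.finrank ℝ F ≤ r) :
    ∃ u : E, u ≠ 0 ∧ L u = 0 ∧ hT.eigenvalues hn r * ‖u‖ ^ 2 ≤ inner ℝ (T u) u := by
  let b := hT.eigenvectorBasis hn
  let L' : E →ₗ[ℝ] F × ({i : Fin n // r < i} → ℝ) :=
    L.prod (LinearMap.pi fun i => (innerₗ E (b i)))
  have hdim : Module.finrank ℝ (F × ({i : Fin n // r < i} → ℝ)) < Module.finrank ℝ E := by
    have : Fintype.card {i : Fin n // r < i} = n - 1 - r := by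
      rw [Fintype.card_subtype, Finset.filter_lt_eq_Ioi, Fin.card_Ioi]
    rw [Module.finrank_prod, Module.finrank_fintype_fun_eq_card, this, hn]
    have := r.2
    omega
  obtain ⟨u, hu, hu0⟩ := (Submodule.ne_bot_iff _).1 (L'.ker_ne_bot_of_finrank_lt hdim)
  have hu' : L u = 0 ∧ ∀ i : Fin n, r < i → inner ℝ (b i) u = 0 := by
    have h := LinearMap.mem_ker.1 hu
    have h2 := congrArg Prod.snd h
    refine ⟨congrArg Prod.fst h, fun i hi => ?_⟩
    simpa [L'] using congrFun h2 ⟨i, hi⟩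
  refine ⟨u, hu0, hu'.1, ?_⟩
  rw [inner_apply_self_eq_sum_eigenvalues hT hn, norm_sq_eq_sum_inner_eigenvectorBasis hT hn,
    Finset.mul_sum]
  refine Finset.sum_le_sum fun i _ => ?_
  rcases lt_or_ge r i with hi | hi
  · have := hu'.2 i hi
    simp only [b] at this
    simp [this]
  · exact mul_le_mul_of_nonneg_right (hT.eigenvalues_antitone hn hi) (sq_nonneg _)

theorem eigenvalues_le_of_forall_ker {T : E →ₗ[ℝ] E} (hT : T.IsSymmetric) {n : ℕ}
    (hn : Module.finrank ℝ E = n) (r : Fin n) (L : E →ₗ[ℝ] F) (hL : Module.finrank ℝ F ≤ r)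
    {c : ℝ} (h : ∀ u, L u = 0 → inner ℝ (T u) u ≤ c * ‖u‖ ^ 2) : hT.eigenvalues hn r ≤ c := by
  obtain ⟨u, hu0, hLu, hu⟩ := exists_eigenvalues_mul_norm_sq_le hT hn r L hL
  have : 0 < ‖u‖ ^ 2 := by positivity
  exact le_of_mul_le_mul_right (hu.trans (h u hLu)) this

/-- A Weyl-type inequality: if `T ≥ S + c` on the kernel of a map of rank at most `r - r'`, then
the eigenvalue of `T` of index `r'` exceeds by `c` the eigenvalue of `S` of index `r`. -/
theorem eigenvalues_add_le_eigenvalues {S T : E →ₗ[ℝ] E} (hS : S.IsSymmetric) (hT : T.IsSymmetric)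
    {n : ℕ} (hn : Module.finrank ℝ E = n) (r r' : Fin n) (L : E →ₗ[ℝ] F)
    (hL : (r' : ℕ) + Module.finrank ℝ F ≤ r) {c : ℝ}
    (h : ∀ u, L u = 0 → inner ℝ (S u) u + c * ‖u‖ ^ 2 ≤ inner ℝ (T u) u) :
    hS.eigenvalues hn r + c ≤ hT.eigenvalues hn r' := by
  let b := hT.eigenvectorBasis hn
  let L' : E →ₗ[ℝ] F × ({i : Fin n // i < r'} → ℝ) :=
    L.prod (LinearMap.pi fun i => (innerₗ E (b i)))
  have hdim : Module.finrank ℝ (F × ({i : Fin n // i < r'} → ℝ)) ≤ r := by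
    have : Fintype.card {i : Fin n // i < r'} = r' := by
      rw [Fintype.card_subtype, Finset.filter_gt_eq_Iio, Fin.card_Iio]
    rw [Module.finrank_prod, Module.finrank_fintype_fun_eq_card, this]
    omega
  obtain ⟨u, hu0, hLu, hu⟩ := exists_eigenvalues_mul_norm_sq_le hS hn r L' hdim
  have hu' : L u = 0 ∧ ∀ i : Fin n, i < r' → inner ℝ (b i) u = 0 := by
    have h2 := congrArg Prod.snd hLu
    refine ⟨congrArg Prod.fst hLu, fun i hi => ?_⟩
    simpa [L'] using congrFun h2 ⟨i, hi⟩
  have hTu : inner ℝ (T u) u ≤ hT.eigenvalues hn r' * ‖u‖ ^ 2 := by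
    rw [inner_apply_self_eq_sum_eigenvalues hT hn, norm_sq_eq_sum_inner_eigenvectorBasis hT hn,
      Finset.mul_sum]
    refine Finset.sum_le_sum fun i _ => ?_
    rcases lt_or_ge i r' with hi | hi
    · have := hu'.2 i hi
      simp only [b] at this
      simp [this]
    · exact mul_le_mul_of_nonneg_right (hT.eigenvalues_antitone hn hi) (sq_nonneg _)
  have hpos : 0 < ‖u‖ ^ 2 := by positivity
  refine le_of_mul_le_mul_right ?_ hpos
  have := h u hu'.1
  linarith

end MinMax

section Jacobi

theorem inner_tridiagonal (v : ℕ → ℝ) (k : ℕ) (u : EuclideanSpace ℝ (Fin k)) :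
    inner ℝ (Matrix.toEuclideanLin (tridiagonal 1 v k) u) u = ∑ i : Fin k, v i * u i ^ 2 +
      inner ℝ (Matrix.toEuclideanLin (tridiagonal 1 (0 : ℕ → ℝ) k) u) u := by
  have : tridiagonal 1 v k = Matrix.diagonal (fun i : Fin k => v i) +
      tridiagonal 1 (0 : ℕ → ℝ) k := by
    ext i j
    by_cases h : i = j
    · subst h; simp [tridiagonal]
    · have h' : (i : ℕ) ≠ j := fun h'' => h (Fin.ext h'')
      simp [tridiagonal, h, h']
  rw [this, map_add, LinearMap.add_apply, inner_add_left]
  congr 1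
  simp [PiLp.inner_apply, Matrix.toLpLin_apply, Matrix.mulVec_diagonal]
  exact Finset.sum_congr rfl fun i _ => by ring

theorem abs_inner_tridiagonal_zero_le (k : ℕ) (u : EuclideanSpace ℝ (Fin k)) :
    |inner ℝ (Matrix.toEuclideanLin (tridiagonal 1 (0 : ℕ → ℝ) k) u) u| ≤ 2 * ‖u‖ ^ 2 := by
  set A := tridiagonal 1 (0 : ℕ → ℝ) k with hA
  have hA0 : ∀ i j, 0 ≤ A i j := by
    intro i j
    simp only [hA, tridiagonal, Matrix.of_apply]
    split_ifs <;> simp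
  have hrow : ∀ i, ∑ j, A i j ≤ 2 := by
    intro i
    have : ∀ j, A i j ≤
        (if (j : ℕ) = i + 1 then 1 else 0) + (if (j : ℕ) + 1 = i then 1 else 0) := by
      intro j
      simp only [hA, tridiagonal, Matrix.of_apply, Pi.zero_apply]
      split_ifs <;> first | omega | norm_num
    refine (Finset.sum_le_sum fun j _ => this j).trans ?_
    rw [Finset.sum_add_distrib, Finset.sum_boole, Finset.sum_boole]
    have h1 : (Finset.univ.filter fun j : Fin k => (j : ℕ) = i + 1).card ≤ 1 :=
      Finset.card_le_one.2 fun a ha b hb => by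
        simp at ha hb; exact Fin.ext (by omega)
    have h2 : (Finset.univ.filter fun j : Fin k => (j : ℕ) + 1 = i).card ≤ 1 :=
      Finset.card_le_one.2 fun a ha b hb => by
        simp at ha hb; exact Fin.ext (by omega)
    have h1' : ((Finset.univ.filter fun j : Fin k => (j : ℕ) = i + 1).card : ℝ) ≤ 1 := by
      exact_mod_cast h1
    have h2' : ((Finset.univ.filter fun j : Fin k => (j : ℕ) + 1 = i).card : ℝ) ≤ 1 := by
      exact_mod_cast h2
    linarith
  have hsymm : ∀ i j, A i j = A j i := fun i j => by
    simpa using ((isHermitian_tridiagonal (0 : ℕ → ℝ) k).apply i j).symm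
  have hexp : inner ℝ (Matrix.toEuclideanLin A u) u = ∑ i, ∑ j, A i j * u j * u i := by
    simp [PiLp.inner_apply, Matrix.toLpLin_apply, Matrix.mulVec, dotProduct, Finset.mul_sum]
    exact Finset.sum_congr rfl fun i _ => Finset.sum_congr rfl fun j _ => by ring
  have hnorm : ‖u‖ ^ 2 = ∑ i, u i ^ 2 := by
    rw [EuclideanSpace.norm_sq_eq]; simp
  have hbound : ∑ i, ∑ j, A i j * (u i ^ 2 + u j ^ 2) ≤ 4 * ‖u‖ ^ 2 := by
    have e1 : ∑ i, ∑ j, A i j * u i ^ 2 ≤ 2 * ‖u‖ ^ 2 := by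
      rw [hnorm, Finset.mul_sum]
      refine Finset.sum_le_sum fun i _ => ?_
      rw [← Finset.sum_mul]
      exact mul_le_mul_of_nonneg_right (hrow i) (sq_nonneg _)
    have e2 : ∑ i, ∑ j, A i j * u j ^ 2 = ∑ i, ∑ j, A i j * u i ^ 2 := by
      rw [Finset.sum_comm]
      exact Finset.sum_congr rfl fun i _ => Finset.sum_congr rfl fun j _ => by rw [hsymm]
    simp only [mul_add, Finset.sum_add_distrib]
    linarith
  have habs : |∑ i, ∑ j, A i j * u j * u i| ≤ ∑ i, ∑ j, A i j * (u i ^ 2 + u j ^ 2) / 2 := by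
    refine (Finset.abs_sum_le_sum_abs _ _).trans (Finset.sum_le_sum fun i _ => ?_)
    refine (Finset.abs_sum_le_sum_abs _ _).trans (Finset.sum_le_sum fun j _ => ?_)
    rw [mul_assoc, abs_mul, abs_of_nonneg (hA0 i j), mul_div_assoc]
    refine mul_le_mul_of_nonneg_left ?_ (hA0 i j)
    rw [abs_le]
    constructor <;> nlinarith [sq_nonneg (u i + u j), sq_nonneg (u i - u j)]
  rw [hexp]
  refine habs.trans ?_
  simp only [← Finset.sum_div]
  linarith

theorem isSymmetric_tridiagonal (v : ℕ → ℝ) (k : ℕ) :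
    (Matrix.toEuclideanLin (tridiagonal 1 v k)).IsSymmetric :=
  Matrix.isSymmetric_toEuclideanLin_iff.mpr (isHermitian_tridiagonal v k)

theorem jacobiEigenvalue_eq (v : ℕ → ℝ) (k : ℕ) (i : Fin k) :
    jacobiEigenvalue v k i = (isSymmetric_tridiagonal v k).eigenvalues finrank_euclideanSpace
      (Fin.cast (Fintype.card_fin k).symm i) := rfl

theorem le_jacobiEigenvalue {v : ℕ → ℝ} {k : ℕ} {c : ℝ} (hc : ∀ i < k, c ≤ v i) (r : Fin k) :
    c - 2 ≤ jacobiEigenvalue v k r := by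
  rw [jacobiEigenvalue_eq]
  set T := Matrix.toEuclideanLin (tridiagonal 1 v k)
  have hT : T.IsSymmetric := isSymmetric_tridiagonal v k
  set r' := Fin.cast (Fintype.card_fin k).symm r
  set u := hT.eigenvectorBasis finrank_euclideanSpace r'
  have hu : ‖u‖ = 1 := (hT.eigenvectorBasis _).orthonormal.1 _
  have h1 : inner ℝ (T u) u = hT.eigenvalues finrank_euclideanSpace r' := by
    rw [hT.apply_eigenvectorBasis, inner_smul_left, real_inner_self_eq_norm_sq, hu]
    simp
  rw [← h1, inner_tridiagonal]
  have h2 := (abs_le.1 (abs_inner_tridiagonal_zero_le k u)).1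
  have h3 : c * ‖u‖ ^ 2 ≤ ∑ i : Fin k, v i * u i ^ 2 := by
    rw [EuclideanSpace.norm_sq_eq, Finset.mul_sum]
    refine Finset.sum_le_sum fun i _ => ?_
    simpa using mul_le_mul_of_nonneg_right (hc i i.2) (sq_nonneg (u i))
  rw [hu] at h2 h3
  linarith

/-- The map extracting the coordinates in `Z`. -/
noncomputable def coordinatesOn {k : ℕ} (Z : Finset (Fin k)) :
    EuclideanSpace ℝ (Fin k) →ₗ[ℝ] (Z → ℝ) :=
  LinearMap.pi fun i => (EuclideanSpace.proj (𝕜 := ℝ) (i : Fin k)).toLinearMap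

theorem coordinatesOn_eq_zero {k : ℕ} {Z : Finset (Fin k)} {u : EuclideanSpace ℝ (Fin k)}
    (hu : coordinatesOn Z u = 0) {i : Fin k} (hi : i ∈ Z) : u i = 0 := by
  simpa [coordinatesOn] using congrFun hu ⟨i, hi⟩

theorem jacobiEigenvalue_le {v : ℕ → ℝ} {k : ℕ} {c : ℝ} (Z : Finset (Fin k))
    (hc : ∀ i ∉ Z, v i ≤ c) (r : Fin k) (hr : Z.card ≤ r) : jacobiEigenvalue v k r ≤ c + 2 := by
  rw [jacobiEigenvalue_eq]
  refine eigenvalues_le_of_forall_ker _ _ _ (coordinatesOn Z) (by simpa using hr) fun u hu => ?_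
  rw [inner_tridiagonal]
  have h2 := (abs_le.1 (abs_inner_tridiagonal_zero_le k u)).2
  have h3 : ∑ i : Fin k, v i * u i ^ 2 ≤ c * ‖u‖ ^ 2 := by
    rw [EuclideanSpace.norm_sq_eq, Finset.mul_sum]
    refine Finset.sum_le_sum fun i _ => ?_
    by_cases hi : i ∈ Z
    · simp [coordinatesOn_eq_zero hu hi]
    · simpa using mul_le_mul_of_nonneg_right (hc i hi) (sq_nonneg (u i))
  linarith

theorem jacobiEigenvalue_add_le {v w : ℕ → ℝ} {k : ℕ} {c : ℝ} (Z : Finset (Fin k))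
    (hc : ∀ i ∉ Z, v i + c ≤ w i) (r r' : Fin k) (hr : (r' : ℕ) + Z.card ≤ r) :
    jacobiEigenvalue v k r + c ≤ jacobiEigenvalue w k r' := by
  rw [jacobiEigenvalue_eq, jacobiEigenvalue_eq]
  refine eigenvalues_add_le_eigenvalues _ _ _ _ _ (coordinatesOn Z) (by simpa using hr)
    fun u hu => ?_
  rw [inner_tridiagonal, inner_tridiagonal w]
  have h3 : ∑ i : Fin k, v i * u i ^ 2 + c * ‖u‖ ^ 2 ≤ ∑ i : Fin k, w i * u i ^ 2 := by
    rw [EuclideanSpace.norm_sq_eq, Finset.mul_sum, ← Finset.sum_add_distrib]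
    refine Finset.sum_le_sum fun i _ => ?_
    by_cases hi : i ∈ Z
    · simp [coordinatesOn_eq_zero hu hi]
    · simpa [add_mul] using mul_le_mul_of_nonneg_right (hc i hi) (sq_nonneg (u i))
  linarith

end Jacobi

section Trajectories

variable {f : ℝ → ℝ} {α γ : ℝ}

theorem Function.Periodic.apply_fract (hf : Function.Periodic f 1) (y : ℝ) :
    f (Int.fract y) = f y := by
  rw [Int.fract]
  simpa using hf.sub_zsmul_eq ⌊y⌋ (x := y)

/-- The number of sites `y + i α`, `i < k`, whose fractional part exceeds that of the `j`-th. -/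
noncomputable def orbitRank (α y : ℝ) {k : ℕ} (j : Fin k) : ℕ :=
  (Finset.univ.filter fun i : Fin k => Int.fract (y + j * α) < Int.fract (y + i * α)).card

theorem orbitRank_lt (α y : ℝ) {k : ℕ} (j : Fin k) : orbitRank α y j < k := by
  have : (Finset.univ.filter fun i : Fin k =>
      Int.fract (y + j * α) < Int.fract (y + i * α)) ⊂ Finset.univ := by
    refine Finset.filter_ssubset.2 ⟨j, Finset.mem_univ _, lt_irrefl _⟩
  simpa [orbitRank] using Finset.card_lt_card this

/-- The position of the `j`-th site among the `k` sites ordered by decreasing fractional part. -/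
noncomputable def orbitPosition (α y : ℝ) {k : ℕ} (j : Fin k) : Fin k :=
  ⟨orbitRank α y j, orbitRank_lt α y j⟩

theorem fract_orbit_injective (hα : Irrational α) (y : ℝ) :
    Function.Injective fun i : ℤ => Int.fract (y + i * α) := by
  intro i j h
  obtain ⟨z, hz⟩ := Int.fract_eq_fract.1 h
  by_contra hij
  have hij' : ((i - j : ℤ) : ℝ) * α = z := by push_cast; linarith
  exact (hα.intCast_mul (sub_ne_zero.2 hij)).ne_int z hij'

theorem orbitPosition_injective (hα : Irrational α) (y : ℝ) {k : ℕ} :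
    Function.Injective (orbitPosition α y (k := k)) := by
  have key : ∀ i j : Fin k, Int.fract (y + i * α) < Int.fract (y + j * α) →
      orbitRank α y j < orbitRank α y i := by
    intro i j hij
    refine Finset.card_lt_card ?_
    rw [Finset.ssubset_iff_of_subset]
    · exact ⟨j, by simpa using hij, by simp⟩
    · intro l hl
      simp only [Finset.mem_filter, Finset.mem_univ, true_and] at hl ⊢
      exact hij.trans hl
  intro i j h
  have h' : orbitRank α y i = orbitRank α y j := congrArg Fin.val h
  rcases lt_trichotomy (Int.fract (y + i * α)) (Int.fract (y + j * α)) with h1 | h1 | h1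
  · exact absurd h' (key i j h1).ne'
  · have := fract_orbit_injective hα y (a₁ := (i : ℤ)) (a₂ := (j : ℤ)) (by simpa using h1)
    exact Fin.ext (by exact_mod_cast this)
  · exact absurd h' (key j i h1).ne

/-- The eigenvalue of the `k`-site operator at phase `w - j α` that follows the value of the
potential at the `j`-th site. -/
noncomputable def trajectory (f : ℝ → ℝ) (α : ℝ) {k : ℕ} (j : Fin k) (w : ℝ) : ℝ :=
  jacobiEigenvalue (fun i => f (w - j * α + i * α)) k (orbitPosition α (w - j * α) j)

theorem trajectory_fract (hf : Function.Periodic f 1) (y : ℝ) {k : ℕ} (j : Fin k) :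
    trajectory f α j (Int.fract (y + j * α)) =
      jacobiEigenvalue (fun i => f (y + i * α)) k (orbitPosition α y j) := by
  have hy : ∀ i : ℕ, Int.fract (y + j * α) - j * α + i * α = y + i * α - ⌊y + j * α⌋ := by
    intro i; rw [Int.fract]; ring
  have h1 : (fun i : ℕ => f (Int.fract (y + j * α) - j * α + i * α)) =
      fun i : ℕ => f (y + i * α) := by
    funext i
    rw [hy i]
    simpa using hf.sub_zsmul_eq ⌊y + j * α⌋ (x := y + i * α)
  have h2 : orbitPosition α (Int.fract (y + j * α) - j * α) j = orbitPosition α y j := by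
    simp [orbitPosition, orbitRank, hy]
  rw [trajectory, h1, h2]

theorem sum_jacobiEigenvalue_eq_sum_trajectory (hα : Irrational α) (hf : Function.Periodic f 1)
    (y : ℝ) (k : ℕ) (h : ℝ → ℝ) :
    ∑ i : Fin k, h (jacobiEigenvalue (fun i => f (y + i * α)) k i) =
      ∑ j : Fin k, h (trajectory f α j (Int.fract (y + j * α))) := by
  have hb : Function.Bijective (orbitPosition α y (k := k)) :=
    Finite.injective_iff_bijective.1 (orbitPosition_injective hα y)
  rw [← hb.sum_comp]
  simp [trajectory_fract hf]

theorem trajectory_add_le (hf : Function.Periodic f 1)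
    (hmono : ∀ a b : ℝ, 0 ≤ a → a < b → b < 1 → γ * (b - a) ≤ f b - f a)
    {k : ℕ} (j : Fin k) {a b : ℝ} (ha : 0 ≤ a) (hab : a < b) (hb : b < 1) :
    trajectory f α j a + γ * (b - a) ≤ trajectory f α j b := by
  set y := a - j * α with hy
  have hyb : b - j * α = y + (b - a) := by rw [hy]; ring
  have hwrap : ∀ i : Fin k, Int.fract (y + i * α) + (b - a) < 1 →
      Int.fract (y + (b - a) + i * α) = Int.fract (y + i * α) + (b - a) := by
    intro i hi
    refine Int.fract_eq_iff.2 ⟨add_nonneg (Int.fract_nonneg _) (by linarith), hi,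
      ⌊y + i * α⌋, ?_⟩
    rw [Int.fract]; ring
  have hwrap' : ∀ i : Fin k, 1 ≤ Int.fract (y + i * α) + (b - a) →
      Int.fract (y + (b - a) + i * α) = Int.fract (y + i * α) + (b - a) - 1 := by
    intro i hi
    refine Int.fract_eq_iff.2 ⟨by linarith, by linarith [Int.fract_lt_one (y + i * α)],
      ⌊y + i * α⌋ + 1, ?_⟩
    rw [Int.fract]; push_cast; ring
  have hja : Int.fract (y + j * α) = a := by
    rw [hy, sub_add_cancel]; exact Int.fract_eq_self.2 ⟨ha, by linarith⟩
  have hjb : Int.fract (y + (b - a) + j * α) = b := by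
    rw [hwrap j (by rw [hja]; linarith), hja]; ring
  set Z := Finset.univ.filter fun i : Fin k => 1 ≤ Int.fract (y + i * α) + (b - a)
  rw [trajectory, trajectory, hyb]
  refine jacobiEigenvalue_add_le Z (fun i hi => ?_) _ _ ?_
  · have hi' : Int.fract (y + i * α) + (b - a) < 1 := by simpa [Z] using hi
    have := hmono _ _ (Int.fract_nonneg (y + i * α)) (by linarith) hi'
    rw [← hwrap i hi', hf.apply_fract, hf.apply_fract, hwrap i hi'] at this
    linarith
  · simp only [orbitPosition, orbitRank]
    rw [hja, hjb, ← Finset.card_union_of_disjoint]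
    · refine Finset.card_le_card ?_
      intro i hi
      simp only [Finset.mem_union, Finset.mem_filter, Finset.mem_univ, true_and, Z] at hi ⊢
      rcases hi with hi | hi
      · by_cases h : Int.fract (y + i * α) + (b - a) < 1
        · rw [hwrap i h] at hi; linarith
        · linarith
      · linarith
    · rw [Finset.disjoint_left]
      intro i hi hi'
      simp only [Finset.mem_filter, Finset.mem_univ, true_and, Z] at hi hi'
      rw [hwrap' i hi'] at hi
      linarith [Int.fract_lt_one (y + i * α)]

theorem trajectory_le (hf : Function.Periodic f 1) (hmono : MonotoneOn f (Set.Ico 0 1))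
    {k : ℕ} (j : Fin k) {w : ℝ} (hw : w ∈ Set.Ico (0 : ℝ) 1) :
    trajectory f α j w ≤ f w + 2 := by
  refine jacobiEigenvalue_le (Finset.univ.filter fun i : Fin k =>
    Int.fract (w - j * α + j * α) < Int.fract (w - j * α + i * α)) (fun i hi => ?_) _ le_rfl
  have hi' : Int.fract (w - j * α + i * α) ≤ Int.fract (w - j * α + j * α) := by simpa using hi
  rw [sub_add_cancel, Int.fract_eq_self.2 hw] at hi'
  rw [← hf.apply_fract]
  exact hmono ⟨Int.fract_nonneg _, Int.fract_lt_one _⟩ hw hi'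

theorem le_trajectory (hf : Function.Periodic f 1) (hmono : MonotoneOn f (Set.Ico 0 1))
    {k : ℕ} (j : Fin k) (w : ℝ) : f 0 - 2 ≤ trajectory f α j w := by
  refine le_jacobiEigenvalue (fun i _ => ?_) _
  rw [← hf.apply_fract (w - j * α + i * α)]
  exact hmono ⟨le_rfl, one_pos⟩ ⟨Int.fract_nonneg _, Int.fract_lt_one _⟩ (Int.fract_nonneg _)

end Trajectories

section LayerCake

open MeasureTheory

/-- Layer-cake comparison of a sum over finitely many points with the integral. -/
theorem sum_le_integral_add_of_card_le {M : ℕ} (w : Fin M → ℝ) {F : ℝ → ℝ} {T T₀ D c : ℝ}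
    (hFm : AEMeasurable F (volume.restrict (Set.Ico 0 1))) (hF0 : ∀ y, 0 ≤ F y)
    (hFT : ∀ y, F y ≤ T) (hT₀ : 0 ≤ T₀) (hT : 0 ≤ T) (hD : 0 ≤ D) (hc : 0 ≤ c)
    (hcard : ∀ t, 0 < t → ((Finset.univ.filter fun m => t ≤ F (w m)).card : ℝ) ≤
      M * (volume.restrict (Set.Ico 0 1)).real {y | t ≤ F y} +
        (if t ≤ T₀ then D else c * Real.exp (T₀ - t)) + 2) :
    ∑ m, F (w m) ≤ M * (∫ y in Set.Ico (0 : ℝ) 1, F y) + (D * T₀ + c + 2 * T) := by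
  set μ : Measure ℝ := volume.restrict (Set.Ico 0 1) with hμ
  have : IsFiniteMeasure μ := by rw [hμ]; infer_instance
  have hInt : Integrable F μ := by
    refine Integrable.of_bound hFm.aestronglyMeasurable T (ae_of_all _ fun y => ?_)
    rw [Real.norm_eq_abs, abs_of_nonneg (hF0 y)]; exact hFT y
  have h1 : ENNReal.ofReal (∑ m, F (w m)) =
      ∫⁻ t in Set.Ioi (0 : ℝ), ((Finset.univ.filter fun m => t ≤ F (w m)).card : ENNReal) := by
    have := lintegral_eq_lintegral_meas_le (Measure.count : Measure (Fin M))
      (f := fun m => F (w m)) (ae_of_all _ fun m => hF0 _) (measurable_of_finite _).aemeasurable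
    rw [lintegral_count, tsum_fintype] at this
    rw [ENNReal.ofReal_sum_of_nonneg fun m _ => hF0 _, this]
    refine lintegral_congr fun t => ?_
    rw [← Measure.count_apply_finset]
    simp
  have h2 : ENNReal.ofReal (∫ y, F y ∂μ) = ∫⁻ t in Set.Ioi (0 : ℝ), μ {y | t ≤ F y} := by
    rw [ofReal_integral_eq_lintegral_ofReal hInt (ae_of_all _ hF0),
      lintegral_eq_lintegral_meas_le μ (ae_of_all _ hF0) hFm]
  have hanti : Measurable fun t : ℝ => μ {y | t ≤ F y} :=
    Antitone.measurable fun s t hst => measure_mono fun y hy => le_trans hst hy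
  set G₁ : ℝ → ENNReal := (Set.Iic T₀).indicator fun _ => ENNReal.ofReal D with hG₁
  set G₂ : ℝ → ENNReal := (Set.Ioi T₀).indicator fun t => ENNReal.ofReal (c * Real.exp (T₀ - t))
    with hG₂
  set G₃ : ℝ → ENNReal := (Set.Iic T).indicator fun _ => 2 with hG₃
  have hG₁m : Measurable G₁ := measurable_const.indicator measurableSet_Iic
  have hG₂m : Measurable G₂ := by
    refine Measurable.indicator ?_ measurableSet_Ioi
    fun_prop
  have h3 : ∀ t ∈ Set.Ioi (0 : ℝ), ((Finset.univ.filter fun m => t ≤ F (w m)).card : ENNReal) ≤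
      ((M : ENNReal) * μ {y | t ≤ F y} + (G₁ t + G₂ t)) + G₃ t := by
    intro t ht
    by_cases htT : t ≤ T
    · have hh := hcard t ht
      have e1 : ((Finset.univ.filter fun m => t ≤ F (w m)).card : ENNReal) =
          ENNReal.ofReal ((Finset.univ.filter fun m => t ≤ F (w m)).card : ℝ) := by simp
      rw [e1]
      have e3 : G₃ t = 2 := by simp [hG₃, htT]
      have e2 : G₁ t + G₂ t = ENNReal.ofReal (if t ≤ T₀ then D else c * Real.exp (T₀ - t)) := by
        by_cases h : t ≤ T₀
        · simp [hG₁, hG₂, h]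
        · simp [hG₁, hG₂, h, not_le.1 h]
      have hnn : 0 ≤ if t ≤ T₀ then D else c * Real.exp (T₀ - t) := by
        split_ifs <;> positivity
      have e4 : (M : ENNReal) * μ {y | t ≤ F y} = ENNReal.ofReal (M * μ.real {y | t ≤ F y}) := by
        rw [ENNReal.ofReal_mul (by positivity)]; simp
      rw [e2, e3, e4, ← ENNReal.ofReal_add (by positivity) hnn, ← ENNReal.ofReal_ofNat,
        ← ENNReal.ofReal_add (by positivity) zero_le_two]
      exact ENNReal.ofReal_le_ofReal hh
    · have : (Finset.univ.filter fun m => t ≤ F (w m)) = ∅ :=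
        Finset.filter_eq_empty_iff.2 fun m _ hm => htT (hm.trans (hFT _))
      simp [this]
  have hI₁ : ∫⁻ t in Set.Ioi (0 : ℝ), G₁ t = ENNReal.ofReal (D * T₀) := by
    rw [hG₁, lintegral_indicator measurableSet_Iic, lintegral_const, Measure.restrict_apply_univ,
      Measure.restrict_apply measurableSet_Iic, Set.inter_comm, Set.Ioi_inter_Iic]
    simp [ENNReal.ofReal_mul hD]
  have hI₃ : ∫⁻ t in Set.Ioi (0 : ℝ), G₃ t = ENNReal.ofReal (2 * T) := by
    rw [hG₃, lintegral_indicator measurableSet_Iic, lintegral_const,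
      Measure.restrict_apply_univ, Measure.restrict_apply measurableSet_Iic, Set.inter_comm,
      Set.Ioi_inter_Iic]
    simp
  have hI₂ : ∫⁻ t in Set.Ioi (0 : ℝ), G₂ t ≤ ENNReal.ofReal c := by
    have hE : IntegrableOn (fun t => c * Real.exp (T₀ - t)) (Set.Ioi T₀) := by
      have : IntegrableOn (fun t => c * Real.exp T₀ * Real.exp (-t)) (Set.Ioi T₀) :=
        (integrableOn_exp_neg_Ioi T₀).const_mul (c * Real.exp T₀)
      refine this.congr_fun (fun t _ => ?_) measurableSet_Ioi
      simp only [sub_eq_add_neg, Real.exp_add]; ring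
    calc ∫⁻ t in Set.Ioi (0 : ℝ), G₂ t ≤ ∫⁻ t, G₂ t := setLIntegral_le_lintegral _ _
      _ = ∫⁻ t in Set.Ioi T₀, ENNReal.ofReal (c * Real.exp (T₀ - t)) := by
          rw [hG₂, lintegral_indicator measurableSet_Ioi]
      _ = ENNReal.ofReal (∫ t in Set.Ioi T₀, c * Real.exp (T₀ - t)) := by
          rw [ofReal_integral_eq_lintegral_ofReal hE (ae_of_all _ fun t => by positivity)]
      _ = ENNReal.ofReal c := by
          congr 1
          have : (fun t => c * Real.exp (T₀ - t)) = fun t => c * Real.exp T₀ * Real.exp (-t) := by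
            funext t; simp only [sub_eq_add_neg, Real.exp_add]; ring
          rw [this, integral_const_mul, integral_exp_neg_Ioi, mul_assoc, ← Real.exp_add]
          simp
      _ ≤ _ := le_rfl
  have hFint : 0 ≤ ∫ y, F y ∂μ := integral_nonneg hF0
  have hfinal : ENNReal.ofReal (∑ m, F (w m)) ≤
      ENNReal.ofReal (M * (∫ y, F y ∂μ) + (D * T₀ + c + 2 * T)) := by
    rw [h1]
    refine (setLIntegral_mono' measurableSet_Ioi h3).trans ?_
    have hm : Measurable fun t => (M : ENNReal) * μ {y | t ≤ F y} + (G₁ t + G₂ t) :=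
      (hanti.const_mul _).add (hG₁m.add hG₂m)
    rw [lintegral_add_left hm,
      lintegral_add_left (hanti.const_mul _), lintegral_add_left hG₁m,
      lintegral_const_mul _ hanti, ← h2, hI₁, hI₃]
    rw [ENNReal.ofReal_add (by positivity) (by positivity),
      ENNReal.ofReal_add (by positivity) (by positivity),
      ENNReal.ofReal_add (by positivity) (by positivity),
      ENNReal.ofReal_mul (Nat.cast_nonneg M), ENNReal.ofReal_natCast, add_assoc]
    gcongr
  exact (ENNReal.ofReal_le_ofReal_iff (by positivity)).1 hfinal

end LayerCake

section ContinuedFractions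

theorem not_terminatedAt_of_irrational {α : ℝ} (hα : Irrational α) (n : ℕ) :
    ¬(GenContFract.of α).TerminatedAt n := by
  intro h
  obtain ⟨r, hr⟩ := GenContFract.exists_rat_eq_of_terminates (v := α) ⟨n, h⟩
  exact hα ⟨r, hr.symm⟩

theorem exists_int_eq_nums {α : ℝ} (hα : Irrational α) (n : ℕ) :
    ∃ p : ℤ, (GenContFract.of α).nums n = p := by
  have hs : ∀ n, ∃ gp z, (GenContFract.of α).s.get? n = some gp ∧ gp.a = 1 ∧ gp.b = (z : ℤ) := by
    intro n
    obtain ⟨gp, hgp⟩ := Option.ne_none_iff_exists'.1 (not_terminatedAt_of_irrational hα n)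
    obtain ⟨h1, z, h2⟩ := GenContFract.of_partNum_eq_one_and_exists_int_partDen_eq hgp
    exact ⟨gp, z, hgp, h1, h2⟩
  induction n using Nat.twoStepInduction with
  | zero => exact ⟨⌊α⌋, by rw [GenContFract.zeroth_num_eq_h, GenContFract.of_h_eq_floor]⟩
  | one =>
    obtain ⟨gp, z, h0, h1, h2⟩ := hs 0
    refine ⟨z * ⌊α⌋ + 1, ?_⟩
    rw [GenContFract.first_num_eq h0, GenContFract.of_h_eq_floor, h1, h2]
    push_cast; ring
  | more n ih₁ ih₂ =>
    obtain ⟨a, ha⟩ := ih₁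
    obtain ⟨b, hb⟩ := ih₂
    obtain ⟨gp, z, h0, h1, h2⟩ := hs (n + 1)
    refine ⟨z * b + a, ?_⟩
    rw [GenContFract.nums_recurrence h0 ha hb, h1, h2]
    push_cast; ring

variable {α : ℝ} {q : ℕ → ℕ}

theorem IsCFDenomSeq.pos (hq : IsCFDenomSeq α q) (hα : Irrational α) (n : ℕ) : 0 < q n := by
  have h := GenContFract.succ_nth_fib_le_of_nth_den (v := α) (n := n)
    (Or.inr (not_terminatedAt_of_irrational hα _))
  rw [← hq n] at h
  have h' : Nat.fib (n + 1) ≤ q n := by exact_mod_cast h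
  exact (Nat.fib_pos.2 n.succ_pos).trans_le h'

theorem IsCFDenomSeq.monotone (hq : IsCFDenomSeq α q) : Monotone q := by
  refine monotone_nat_of_le_succ fun n => ?_
  have h := GenContFract.of_den_mono (v := α) (n := n)
  rw [← hq n, ← hq (n + 1)] at h
  exact_mod_cast h

theorem IsCFDenomSeq.tendsto (hq : IsCFDenomSeq α q) (hα : Irrational α) :
    Tendsto q atTop atTop := by
  refine tendsto_atTop_mono' atTop (f₁ := fun n => n) ?_ tendsto_id
  filter_upwards [eventually_ge_atTop 5] with n hn
  have h := GenContFract.succ_nth_fib_le_of_nth_den (v := α) (n := n)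
    (Or.inr (not_terminatedAt_of_irrational hα _))
  rw [← hq n] at h
  have h' : Nat.fib (n + 1) ≤ q n := by exact_mod_cast h
  have := Nat.le_fib_self hn
  have : Nat.fib n ≤ Nat.fib (n + 1) := Nat.fib_mono (Nat.le_succ n)
  omega

theorem IsCFDenomSeq.exists_isCoprime (hq : IsCFDenomSeq α q) (hα : Irrational α) (n : ℕ) :
    ∃ p : ℤ, IsCoprime p (q n) ∧ |q n * α - p| ≤ 1 / q (n + 1) := by
  obtain ⟨p, hp⟩ := exists_int_eq_nums hα n
  obtain ⟨p', hp'⟩ := exists_int_eq_nums hα (n + 1)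
  have hpos : (0 : ℝ) < q n := by exact_mod_cast hq.pos hα n
  have hpos' : (0 : ℝ) < q (n + 1) := by exact_mod_cast hq.pos hα (n + 1)
  refine ⟨p, ?_, ?_⟩
  · have h := SimpContFract.determinant (s := SimpContFract.of α) (n := n)
      (not_terminatedAt_of_irrational hα n)
    have hco : ((SimpContFract.of α : SimpContFract ℝ) : GenContFract ℝ) = GenContFract.of α := rfl
    rw [hco, hp, hp', ← hq n, ← hq (n + 1)] at h
    have h' : p * (q (n + 1) : ℤ) - (q n : ℤ) * p' = (-1) ^ (n + 1) := by exact_mod_cast h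
    have hu : ((-1 : ℤ) ^ (n + 1)) * (-1) ^ (n + 1) = 1 := by
      rw [← pow_add, ← two_mul]; simp
    exact ⟨(-1) ^ (n + 1) * q (n + 1), -((-1) ^ (n + 1) * p'), by
      linear_combination (-1) ^ (n + 1) * h' + hu⟩
  · have h := GenContFract.abs_sub_convs_le (not_terminatedAt_of_irrational hα n)
    rw [GenContFract.conv_eq_num_div_den, hp, ← hq n, ← hq (n + 1)] at h
    have e : q n * α - p = q n * (α - p / q n) := by field_simp
    rw [e, abs_mul, abs_of_pos hpos]
    calc (q n : ℝ) * |α - p / q n| ≤ q n * (1 / (q n * q (n + 1))) := by gcongr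
      _ = 1 / q (n + 1) := by field_simp

end ContinuedFractions

section Counting

open MeasureTheory

theorem card_int_le_of_subset_Icc (s : Finset ℤ) {a b : ℝ} (hab : a ≤ b)
    (h : ∀ z ∈ s, a ≤ z ∧ (z : ℝ) ≤ b) : (s.card : ℝ) ≤ b - a + 1 := by
  have hsub : s ⊆ Finset.Icc ⌈a⌉ ⌊b⌋ := fun z hz =>
    Finset.mem_Icc.2 ⟨Int.ceil_le.2 (h z hz).1, Int.le_floor.2 (h z hz).2⟩
  have h1 := Finset.card_le_card hsub
  rw [Int.card_Icc] at h1
  have h2 : ((⌊b⌋ + 1 - ⌈a⌉).toNat : ℝ) ≤ b - a + 1 := by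
    rcases le_total 0 (⌊b⌋ + 1 - ⌈a⌉) with h0 | h0
    · have : ((⌊b⌋ + 1 - ⌈a⌉).toNat : ℝ) = ((⌊b⌋ + 1 - ⌈a⌉ : ℤ) : ℝ) := by
        exact_mod_cast Int.toNat_of_nonneg h0
      rw [this]; push_cast
      linarith [Int.floor_le b, Int.le_ceil a]
    · rw [Int.toNat_of_nonpos h0]; push_cast; linarith
  have h3 : (s.card : ℝ) ≤ ((⌊b⌋ + 1 - ⌈a⌉).toNat : ℝ) := by exact_mod_cast h1
  linarith

/-- A discrepancy bound for `N` consecutive orbit points, `p / N` being a reduced fraction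
close to `α`. -/
theorem card_orbit_le {α δ : ℝ} {N : ℕ} {p : ℤ} (hN : 0 < N) (hp : IsCoprime p N)
    (hδ : |N * α - p| ≤ δ) (y : ℝ) {S : Set ℝ} [DecidablePred (· ∈ S)]
    (hS : S.OrdConnected) (hS1 : S ⊆ Set.Ico 0 1) :
    (((Finset.range N).filter fun m : ℕ => Int.fract (y + m * α) ∈ S).card : ℝ) ≤
      N * volume.real S + N * δ + 1 := by
  set A := (Finset.range N).filter fun m : ℕ => Int.fract (y + m * α) ∈ S with hA
  have hδ0 : 0 ≤ δ := (abs_nonneg _).trans hδ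
  have hN0 : (0 : ℝ) < N := by exact_mod_cast hN
  rcases A.eq_empty_or_nonempty with he | hne
  · rw [he]; simp; positivity
  obtain ⟨m₀, hm₀, hmin⟩ := A.exists_min_image (fun m : ℕ => Int.fract (y + m * α)) hne
  obtain ⟨m₁, hm₁, hmax⟩ := A.exists_max_image (fun m : ℕ => Int.fract (y + m * α)) hne
  set s := Int.fract (y + m₀ * α)
  set t := Int.fract (y + m₁ * α)
  have hs : s ∈ S := (Finset.mem_filter.1 hm₀).2
  have ht : t ∈ S := (Finset.mem_filter.1 hm₁).2
  have hst : s ≤ t := hmax m₀ hm₀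
  have hvol : t - s ≤ volume.real S := by
    have h1 : volume.real (Set.Icc s t) ≤ volume.real S :=
      measureReal_mono (hS.out hs ht)
        (ne_top_of_le_ne_top (by simp) (measure_mono hS1 (μ := volume)))
    rwa [Real.volume_real_Icc_of_le hst] at h1
  set c : ℕ → ℤ := fun m => m * p - N * ⌊y + m * α⌋ with hc
  have hcinj : Set.InjOn c A := by
    intro a ha b hb hab
    have haN := Finset.mem_range.1 (Finset.mem_filter.1 ha).1
    have hbN := Finset.mem_range.1 (Finset.mem_filter.1 hb).1
    have h1 : (N : ℤ) ∣ ((a : ℤ) - b) * p :=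
      ⟨⌊y + a * α⌋ - ⌊y + b * α⌋, by simp only [hc] at hab; linear_combination hab⟩
    have h2 : (N : ℤ) ∣ (a : ℤ) - b := hp.symm.dvd_of_dvd_mul_right h1
    have h3 := Int.eq_zero_of_abs_lt_dvd h2 (by rw [abs_lt]; omega)
    omega
  have hcard : (A.card : ℝ) = ((A.image c).card : ℝ) := by rw [Finset.card_image_of_injOn hcinj]
  rw [hcard]
  set θ := N * α - p with hθ
  have key : ∀ m ∈ A, (c m : ℝ) = N * (Int.fract (y + m * α) - y) - m * θ := by
    intro m _
    simp only [hc, hθ, Int.fract]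
    push_cast; ring
  have hmθ : ∀ m ∈ A, min 0 (N * θ) ≤ m * θ ∧ m * θ ≤ max 0 (N * θ) := by
    intro m hm
    have hmN : (m : ℝ) ≤ N := by exact_mod_cast (Finset.mem_range.1 (Finset.mem_filter.1 hm).1).le
    have hm0 : (0 : ℝ) ≤ m := by positivity
    rcases le_total 0 θ with h | h
    · exact ⟨min_le_of_left_le (by positivity), le_max_of_le_right (by gcongr)⟩
    · exact ⟨min_le_of_right_le (by nlinarith), le_max_of_le_left (by nlinarith)⟩
  have hlen : max 0 (N * θ) - min 0 (N * θ) ≤ N * δ := by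
    rw [max_sub_min_eq_abs, sub_zero, abs_mul, abs_of_pos hN0]; gcongr
  have := card_int_le_of_subset_Icc (A.image c) (a := N * (s - y) - max 0 (N * θ))
    (b := N * (t - y) - min 0 (N * θ)) (by
      have : N * (s - y) ≤ N * (t - y) := by gcongr
      have : min 0 (N * θ) ≤ max 0 (N * θ) := min_le_max
      linarith) (by
      intro z hz
      obtain ⟨m, hm, rfl⟩ := Finset.mem_image.1 hz
      rw [key m hm]
      have h1 := hmθ m hm
      have h2 := hmin m hm
      have h3 := hmax m hm
      have h4 : N * (s - y) ≤ N * (Int.fract (y + m * α) - y) := by gcongr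
      have h5 : N * (Int.fract (y + m * α) - y) ≤ N * (t - y) := by gcongr
      exact ⟨by linarith, by linarith⟩)
  have h6 : N * (t - s) ≤ N * volume.real S := by gcongr
  linarith

theorem card_orbit_mul_le {α δ : ℝ} {N : ℕ} {p : ℤ} (hN : 0 < N) (hp : IsCoprime p N)
    (hδ : |N * α - p| ≤ δ) (y : ℝ) {S : Set ℝ} [DecidablePred (· ∈ S)]
    (hS : S.OrdConnected) (hS1 : S ⊆ Set.Ico 0 1)
    (Λ : ℕ) :
    (((Finset.range (Λ * N)).filter fun m : ℕ => Int.fract (y + m * α) ∈ S).card : ℝ) ≤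
      (Λ * N : ℕ) * volume.real S + Λ * (N * δ + 1) := by
  induction Λ with
  | zero => simp
  | succ Λ ih =>
    have h := card_orbit_le hN hp hδ (y + (Λ * N : ℕ) * α) hS hS1
    have e : ((Finset.range ((Λ + 1) * N)).filter fun m : ℕ => Int.fract (y + m * α) ∈ S).card =
        ((Finset.range (Λ * N)).filter fun m : ℕ => Int.fract (y + m * α) ∈ S).card +
        ((Finset.range N).filter fun m : ℕ =>
          Int.fract (y + (Λ * N : ℕ) * α + m * α) ∈ S).card := by
      rw [Finset.card_filter, Finset.card_filter, Finset.card_filter, Nat.succ_mul,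
        Finset.sum_range_add]
      congr 1
      refine Finset.sum_congr rfl fun m _ => ?_
      have : y + ((Λ * N + m : ℕ) : ℝ) * α = y + (Λ * N : ℕ) * α + m * α := by push_cast; ring
      rw [this]
    rw [e]
    push_cast at ih h ⊢
    linarith

end Counting

section LogDistance

open MeasureTheory

variable {g : ℝ → ℝ} {γ E η : ℝ}

theorem norm_add_mul_I_sub_eq_sqrt (E η t : ℝ) :
    ‖(E + η * Complex.I - t : ℂ)‖ = Real.sqrt ((t - E) ^ 2 + η ^ 2) := by
  have : (E + η * Complex.I - t : ℂ) = ((E - t : ℝ) : ℂ) + (η : ℝ) * Complex.I := by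
    push_cast; ring
  rw [this, Complex.norm_add_mul_I]
  congr 1; ring

theorem le_norm_add_mul_I_sub (E η t : ℝ) : η ≤ ‖(E + η * Complex.I - t : ℂ)‖ := by
  rw [norm_add_mul_I_sub_eq_sqrt]
  exact Real.le_sqrt_of_sq_le (by nlinarith [sq_nonneg (t - E)])

theorem abs_sub_le_norm_add_mul_I_sub (E η t : ℝ) :
    |t - E| ≤ ‖(E + η * Complex.I - t : ℂ)‖ := by
  rw [norm_add_mul_I_sub_eq_sqrt]
  exact Real.le_sqrt_of_sq_le (by rw [sq_abs]; nlinarith [sq_nonneg η])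

theorem norm_add_mul_I_sub_le_max {s t u : ℝ} (hst : s ≤ t) (htu : t ≤ u) :
    ‖(E + η * Complex.I - t : ℂ)‖ ≤
      max ‖(E + η * Complex.I - s : ℂ)‖ ‖(E + η * Complex.I - u : ℂ)‖ := by
  simp only [norm_add_mul_I_sub_eq_sqrt, le_max_iff]
  rcases le_total t E with h | h
  · exact Or.inl (Real.sqrt_le_sqrt (by nlinarith))
  · exact Or.inr (Real.sqrt_le_sqrt (by nlinarith))

theorem measurable_log_norm_add_mul_I_sub (E η : ℝ) :
    Measurable fun t : ℝ => Real.log ‖(E + η * Complex.I - t : ℂ)‖ := by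
  have : Continuous fun t : ℝ => ‖(E + η * Complex.I - t : ℂ)‖ := by fun_prop
  exact this.measurable.log

/-- Lower bound for the sum of `log |z - g|` over points obeying a counting estimate. -/
theorem le_sum_log_norm_of_card_le (hγ : 0 < γ) (hη : 0 < η) (hη1 : η ≤ 1)
    (hg : ∀ a b : ℝ, 0 ≤ a → a < b → b < 1 → g a + γ * (b - a) ≤ g b)
    {a T₀ D c : ℝ} (ha : 0 ≤ a) (hT₀ : 0 ≤ T₀) (hD : 0 ≤ D) (hc : 0 ≤ c) {M : ℕ} (w : ℕ → ℝ)
    (hw : ∀ m, w m ∈ Set.Ico (0 : ℝ) 1)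
    (hcard : ∀ (t : ℝ) (S : Set ℝ) [DecidablePred (· ∈ S)], S.OrdConnected → S ⊆ Set.Ico 0 1 →
      volume.real S ≤ 2 * Real.exp (a - t) / γ →
      (((Finset.range M).filter fun m => w m ∈ S).card : ℝ) ≤
        M * volume.real S + (if t ≤ T₀ then D else c * Real.exp (T₀ - t)) + 2) :
    M * (∫ y in Set.Ico (0 : ℝ) 1, min (Real.log ‖(E + η * Complex.I - g y : ℂ)‖) a) -
        (D * T₀ + c + 2 * (a - Real.log η)) ≤
      ∑ m ∈ Finset.range M, Real.log ‖(E + η * Complex.I - g (w m) : ℂ)‖ := by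
  set h : ℝ → ℝ := fun y => Real.log ‖(E + η * Complex.I - g y : ℂ)‖ with hh
  set F : ℝ → ℝ := fun y => max (a - h y) 0 with hF
  have hlogη : Real.log η ≤ 0 := Real.log_nonpos hη.le hη1
  have hpos : ∀ y, 0 < ‖(E + η * Complex.I - g y : ℂ)‖ := fun y =>
    hη.trans_le (le_norm_add_mul_I_sub _ _ _)
  have hge : ∀ y, Real.log η ≤ h y := fun y =>
    Real.log_le_log hη (le_norm_add_mul_I_sub _ _ _)
  have hmono : MonotoneOn g (Set.Ico 0 1) := by
    intro s hs t ht hst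
    rcases hst.eq_or_lt with rfl | hlt
    · exact le_rfl
    · have := hg s t hs.1 hlt ht.2
      nlinarith
  have hgm : AEMeasurable g (volume.restrict (Set.Ico 0 1)) :=
    aemeasurable_restrict_of_monotoneOn measurableSet_Ico hmono
  have hhm : AEMeasurable h (volume.restrict (Set.Ico 0 1)) :=
    (measurable_log_norm_add_mul_I_sub E η).comp_aemeasurable hgm
  have hFm : AEMeasurable F (volume.restrict (Set.Ico 0 1)) :=
    (aemeasurable_const.sub hhm).max aemeasurable_const
  have hFT : ∀ y, F y ≤ a - Real.log η := fun y =>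
    max_le (by linarith [hge y]) (by linarith)
  have hlevel : ∀ t, 0 < t → ∀ y, t ≤ F y ↔ ‖(E + η * Complex.I - g y : ℂ)‖ ≤ Real.exp (a - t) := by
    intro t ht y
    rw [← Real.log_le_iff_le_exp (hpos y), le_max_iff]
    constructor
    · rintro (h1 | h1)
      · simp only [hh] at h1; linarith
      · linarith
    · intro h1; left; simp only [hh]; linarith
  have key := sum_le_integral_add_of_card_le (M := M) (fun m : Fin M => w m) (F := F)
    (T := a - Real.log η) (T₀ := T₀) (D := D) (c := c) hFm (fun y => le_max_right _ _) hFT hT₀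
    (by linarith) hD hc (by
      intro t ht
      classical
      set S : Set ℝ := {y | y ∈ Set.Ico (0 : ℝ) 1 ∧ t ≤ F y} with hS
      have hSo : S.OrdConnected := by
        refine ⟨fun s hs u hu v hv => ?_⟩
        have hv1 : v ∈ Set.Ico (0 : ℝ) 1 := ⟨hs.1.1.trans hv.1, hv.2.trans_lt hu.1.2⟩
        refine ⟨hv1, (hlevel t ht v).2 ?_⟩
        exact (norm_add_mul_I_sub_le_max (hmono hs.1 hv1 hv.1) (hmono hv1 hu.1 hv.2)).trans
          (max_le ((hlevel t ht s).1 hs.2) ((hlevel t ht u).1 hu.2))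
      have hSd : ∀ s ∈ S, ∀ u ∈ S, s < u → u - s ≤ 2 * Real.exp (a - t) / γ := by
        intro s hs u hu hsu
        have h1 := (abs_sub_le_norm_add_mul_I_sub E η (g s)).trans ((hlevel t ht s).1 hs.2)
        have h2 := (abs_sub_le_norm_add_mul_I_sub E η (g u)).trans ((hlevel t ht u).1 hu.2)
        have h3 := hg s u hs.1.1 hsu hu.1.2
        rw [le_div_iff₀ hγ]
        linarith [(abs_le.1 h1).1, (abs_le.1 h2).2]
      have hSv : volume.real S ≤ 2 * Real.exp (a - t) / γ := by
        have h1 : volume S ≤ ENNReal.ofReal (2 * Real.exp (a - t) / γ) := by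
          refine (Real.volume_le_diam S).trans (Metric.ediam_le fun s hs u hu => ?_)
          rw [edist_dist]
          refine ENNReal.ofReal_le_ofReal ?_
          rw [Real.dist_eq]
          rcases lt_trichotomy s u with h | h | h
          · rw [abs_sub_comm, abs_of_pos (by linarith)]; exact hSd s hs u hu h
          · rw [h]; simp; positivity
          · rw [abs_of_pos (by linarith)]; exact hSd u hu s hs h
        exact ENNReal.toReal_le_of_le_ofReal (by positivity) h1
      have h4 := hcard t S hSo (fun y hy => hy.1) hSv
      have e1 : (Finset.univ.filter fun m : Fin M => t ≤ F (w m)).card =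
          ((Finset.range M).filter fun m => w m ∈ S).card := by
        rw [Finset.card_filter, Finset.card_filter, Finset.sum_range]
        refine Finset.sum_congr rfl fun m _ => ?_
        simp [hS, (hw m).1, (hw m).2]
      have e2 : (volume.restrict (Set.Ico (0 : ℝ) 1)).real {y | t ≤ F y} = volume.real S := by
        rw [measureReal_restrict_apply' measurableSet_Ico]
        congr 1
        ext y
        simp [hS, and_comm]
      rw [e1, e2]
      exact h4)
  have hFint : Integrable F (volume.restrict (Set.Ico 0 1)) := by
    refine Integrable.of_bound hFm.aestronglyMeasurable (a - Real.log η) (ae_of_all _ fun y => ?_)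
    rw [Real.norm_eq_abs, abs_of_nonneg (le_max_right _ _)]; exact hFT y
  have hmin : ∀ y, min (h y) a = a - F y := by
    intro y
    simp only [hF]
    rcases le_total (h y) a with h1 | h1
    · rw [min_eq_left h1, max_eq_left (by linarith)]; ring
    · rw [min_eq_right h1, max_eq_right (by linarith)]; ring
  have e3 : (∫ y in Set.Ico (0 : ℝ) 1, min (h y) a) = a - ∫ y in Set.Ico (0 : ℝ) 1, F y := by
    simp_rw [hmin]
    rw [integral_sub (integrable_const _) hFint]
    simp
  have e4 : ∀ m, a - F (w m) ≤ h (w m) := fun m => by rw [← hmin]; exact min_le_left _ _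
  have e5 := Finset.sum_le_sum fun m (_ : m ∈ Finset.range M) => e4 m
  rw [Finset.sum_sub_distrib] at e5
  rw [Fin.sum_univ_eq_sum_range (fun m => F (w m))] at key
  simp only [Finset.sum_const, Finset.card_range, nsmul_eq_mul] at e5
  rw [e3]
  linarith

end LogDistance

section OrbitSums

open MeasureTheory

variable {f : ℝ → ℝ} {α γ E η : ℝ}

theorem exists_integral_max_sub_le {X : Type*} [MeasurableSpace X] {μ : Measure X} {H : X → ℝ}
    (hH : Integrable H μ) {ε : ℝ} (hε : 0 < ε) (a₀ : ℝ) :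
    ∃ a, a₀ ≤ a ∧ ∫ y, max (H y - a) 0 ∂μ ≤ ε := by
  have h : Tendsto (fun n : ℕ => ∫ y, max (H y - n) 0 ∂μ) atTop (nhds (∫ _, (0 : ℝ) ∂μ)) := by
    refine tendsto_integral_of_dominated_convergence (fun y => |H y|) (fun n => ?_) hH.abs
      (fun n => ae_of_all _ fun y => ?_) (ae_of_all _ fun y => ?_)
    · exact (hH.aestronglyMeasurable.sub aestronglyMeasurable_const).sup
        aestronglyMeasurable_const
    · rw [Real.norm_eq_abs, abs_of_nonneg (le_max_right _ _)]
      refine max_le ?_ (abs_nonneg _)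
      have : (0 : ℝ) ≤ n := by positivity
      linarith [le_abs_self (H y)]
    · refine tendsto_const_nhds.congr' ?_
      filter_upwards [eventually_ge_atTop ⌈H y⌉₊] with n hn
      rw [max_eq_right]
      linarith [Nat.ceil_le.1 hn]
  rw [integral_zero] at h
  obtain ⟨n, hn, hn'⟩ := ((h.eventually (ge_mem_nhds hε)).and
    (eventually_ge_atTop ⌈a₀⌉₊)).exists
  exact ⟨n, Nat.ceil_le.1 hn', hn⟩

theorem intervalIntegral_comp_fract_add (H : ℝ → ℝ) (c : ℝ) :
    ∫ y in (0 : ℝ)..1, H (Int.fract (y + c)) = ∫ y in Set.Ico (0 : ℝ) 1, H y := by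
  have hper : Function.Periodic (fun y => H (Int.fract y)) 1 := fun y => by simp
  rw [intervalIntegral.integral_comp_add_right (fun y => H (Int.fract y)), zero_add, add_comm 1 c,
    hper.intervalIntegral_add_eq c 0, zero_add, intervalIntegral.integral_of_le zero_le_one,
    ← integral_Ico_eq_integral_Ioc]
  refine setIntegral_congr_fun measurableSet_Ico fun y hy => ?_
  simp only [Int.fract_eq_self.2 hy]

theorem intervalIntegrable_comp_fract_add {H : ℝ → ℝ} (hH : IntegrableOn H (Set.Ico 0 1)) (c : ℝ) :
    IntervalIntegrable (fun y => H (Int.fract (y + c))) volume 0 1 := by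
  have h0 : IntervalIntegrable (fun y => H (Int.fract y)) volume 0 1 := by
    rw [intervalIntegrable_iff_integrableOn_Ico_of_le zero_le_one]
    exact hH.congr_fun (fun y hy => by simp only [Int.fract_eq_self.2 hy]) measurableSet_Ico
  have hper : Function.Periodic (fun y => H (Int.fract y)) 1 := fun y => by simp
  simpa using (hper.intervalIntegrable₀ one_ne_zero h0 (0 + c) (1 + c)).comp_add_right c

theorem MonotonePotential.monotoneOn (hf : MonotonePotential f γ) :
    MonotoneOn f (Set.Ico 0 1) := by
  obtain ⟨hγ, -, hmono, -⟩ := hf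
  intro s hs t ht hst
  rcases hst.eq_or_lt with rfl | hlt
  · exact le_rfl
  · have := hmono s t hs.1 hlt ht.2
    nlinarith

theorem MonotonePotential.integrableOn (hf : MonotonePotential f γ) :
    IntegrableOn (fun y => Real.log (1 + |f y|)) (Set.Ico 0 1) :=
  (integrableOn_Ico_iff_integrableOn_Ioo (by finiteness)).2 hf.2.2.2

theorem log_norm_continuant_eq_sum_trajectory (hα : Irrational α) (hf : MonotonePotential f γ)
    (hη : 0 < η) (k : ℕ) (y : ℝ) :
    Real.log ‖continuant (fun i : ℕ => (E + η * Complex.I - f (y + i * α) : ℂ)) k‖ =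
      ∑ j : Fin k,
        Real.log ‖(E + η * Complex.I - trajectory f α j (Int.fract (y + j * α)) : ℂ)‖ := by
  rw [continuant_eq_prod_jacobiEigenvalue (fun i : ℕ => f (y + i * α)), norm_prod,
    Real.log_prod]
  · exact sum_jacobiEigenvalue_eq_sum_trajectory hα hf.2.1 y k
      (fun t => Real.log ‖(E + η * Complex.I - t : ℂ)‖)
  · intro i _
    exact (hη.trans_le (le_norm_add_mul_I_sub _ _ _)).ne'

theorem log_norm_sub_trajectory_le (hf : MonotonePotential f γ) (hη : 0 < η) (hη1 : η ≤ 1)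
    {k : ℕ} (j : Fin k) {w : ℝ} (hw : w ∈ Set.Ico (0 : ℝ) 1) :
    Real.log ‖(E + η * Complex.I - trajectory f α j w : ℂ)‖ ≤
      Real.log (|E| + |f 0| + 4) + Real.log (1 + |f w|) := by
  have h1 := trajectory_le (α := α) hf.2.1 hf.monotoneOn j hw
  have h2 := le_trajectory (α := α) hf.2.1 hf.monotoneOn j w
  have h3 : |trajectory f α j w| ≤ |f w| + |f 0| + 2 := by
    rw [abs_le]
    constructor <;>
      linarith [abs_le.1 (le_refl |f w|), abs_le.1 (le_refl |f 0|), abs_nonneg (f w),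
        abs_nonneg (f 0), le_abs_self (f w), neg_abs_le (f 0)]
  rw [← Real.log_mul (by positivity) (by positivity)]
  refine Real.log_le_log (hη.trans_le (le_norm_add_mul_I_sub _ _ _)) ?_
  calc ‖(E + η * Complex.I - trajectory f α j w : ℂ)‖
      ≤ ‖(E : ℂ)‖ + ‖(η * Complex.I : ℂ)‖ + ‖(trajectory f α j w : ℂ)‖ :=
        (norm_sub_le _ _).trans (by gcongr; exact norm_add_le _ _)
    _ = |E| + η + |trajectory f α j w| := by simp [abs_of_pos hη]
    _ ≤ |E| + 1 + (|f w| + |f 0| + 2) := by gcongr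
    _ ≤ (|E| + |f 0| + 4) * (1 + |f w|) := by
        nlinarith [abs_nonneg E, abs_nonneg (f 0), abs_nonneg (f w),
          mul_nonneg (abs_nonneg E) (abs_nonneg (f w)),
          mul_nonneg (abs_nonneg (f 0)) (abs_nonneg (f w))]

theorem integrableOn_log_norm_sub_trajectory (hf : MonotonePotential f γ) (hη : 0 < η)
    (hη1 : η ≤ 1) {k : ℕ} (j : Fin k) :
    IntegrableOn (fun w => Real.log ‖(E + η * Complex.I - trajectory f α j w : ℂ)‖)
      (Set.Ico 0 1) := by
  have hmono : MonotoneOn (trajectory f α j) (Set.Ico 0 1) := by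
    intro s hs t ht hst
    rcases hst.eq_or_lt with rfl | hlt
    · exact le_rfl
    · have := trajectory_add_le (α := α) hf.2.1 hf.2.2.1 j hs.1 hlt ht.2
      nlinarith [hf.1]
  have hm : AEMeasurable (trajectory f α j) (volume.restrict (Set.Ico 0 1)) :=
    aemeasurable_restrict_of_monotoneOn measurableSet_Ico hmono
  refine integrable_of_le_of_le
    ((measurable_log_norm_add_mul_I_sub E η).comp_aemeasurable hm).aestronglyMeasurable
    (g₁ := fun _ => Real.log η)
    (g₂ := fun w => Real.log (|E| + |f 0| + 4) + Real.log (1 + |f w|))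
    (ae_of_all _ fun w => Real.log_le_log hη (le_norm_add_mul_I_sub _ _ _))
    ?_ (integrable_const _) ((integrable_const _).add hf.integrableOn)
  filter_upwards [ae_restrict_mem measurableSet_Ico] with w hw
  exact log_norm_sub_trajectory_le hf hη hη1 j hw

theorem intervalIntegrable_log_norm_continuant (hα : Irrational α) (hf : MonotonePotential f γ)
    (hη : 0 < η) (hη1 : η ≤ 1) (k : ℕ) (c : ℝ) :
    IntervalIntegrable (fun y => Real.log
      ‖continuant (fun i : ℕ => (E + η * Complex.I - f (y + c + i * α) : ℂ)) k‖) volume 0 1 := by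
  simp_rw [log_norm_continuant_eq_sum_trajectory hα hf hη]
  have := IntervalIntegrable.sum (μ := volume) (a := 0) (b := 1) (Finset.univ : Finset (Fin k))
    (f := fun j y => Real.log
      ‖(E + η * Complex.I - trajectory f α j (Int.fract (y + (c + j * α))) : ℂ)‖)
    fun j _ => intervalIntegrable_comp_fract_add
      (integrableOn_log_norm_sub_trajectory hf hη hη1 j) (c + j * α)
  simpa [add_assoc, Finset.sum_fn] using this

theorem integral_log_norm_continuant (hα : Irrational α) (hf : MonotonePotential f γ)
    (hη : 0 < η) (hη1 : η ≤ 1) (k : ℕ) (c : ℝ) :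
    ∫ y in (0 : ℝ)..1, Real.log
      ‖continuant (fun i : ℕ => (E + η * Complex.I - f (y + c + i * α) : ℂ)) k‖ =
    ∑ j : Fin k, ∫ w in Set.Ico (0 : ℝ) 1,
      Real.log ‖(E + η * Complex.I - trajectory f α j w : ℂ)‖ := by
  simp_rw [log_norm_continuant_eq_sum_trajectory hα hf hη]
  have h : ∀ j ∈ (Finset.univ : Finset (Fin k)), IntervalIntegrable (fun y => Real.log
      ‖(E + η * Complex.I - trajectory f α j (Int.fract (y + (c + j * α))) : ℂ)‖) volume 0 1 :=
    fun j _ => intervalIntegrable_comp_fract_add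
      (integrableOn_log_norm_sub_trajectory hf hη hη1 j) (c + j * α)
  simp_rw [add_assoc]
  rw [intervalIntegral.integral_finsetSum h]
  exact Finset.sum_congr rfl fun j _ => intervalIntegral_comp_fract_add
    (fun w => Real.log ‖(E + η * Complex.I - trajectory f α j w : ℂ)‖) _

/-- Averages of `log |P_k|` along an orbit are bounded below by the phase average. -/
theorem le_sum_log_norm_continuant (hα : Irrational α) (hf : MonotonePotential f γ)
    (hη : 0 < η) (hη1 : η ≤ 1) (k : ℕ) (x : ℝ) {a T₀ D c ε : ℝ} (ha : 0 ≤ a)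
    (htail : ∫ y in Set.Ico (0 : ℝ) 1,
      max (Real.log (|E| + |f 0| + 4) + Real.log (1 + |f y|) - a) 0 ≤ ε)
    (hT₀ : 0 ≤ T₀) (hD : 0 ≤ D) (hc : 0 ≤ c) {M : ℕ}
    (hcard : ∀ (y t : ℝ) (S : Set ℝ) [DecidablePred (· ∈ S)], S.OrdConnected →
      S ⊆ Set.Ico 0 1 → volume.real S ≤ 2 * Real.exp (a - t) / γ →
      (((Finset.range M).filter fun m : ℕ => Int.fract (y + m * α) ∈ S).card : ℝ) ≤
        M * volume.real S + (if t ≤ T₀ then D else c * Real.exp (T₀ - t)) + 2) :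
    M * ((∫ y in (0 : ℝ)..1, Real.log
        ‖continuant (fun i : ℕ => (E + η * Complex.I - f (y + α + i * α) : ℂ)) k‖) - k * ε) -
        k * (D * T₀ + c + 2 * (a - Real.log η)) ≤
      ∑ m ∈ Finset.range M, Real.log
        ‖continuant (fun i : ℕ => (E + η * Complex.I - f (x + m * α + i * α) : ℂ)) k‖ := by
  rw [integral_log_norm_continuant hα hf hη hη1]
  simp_rw [log_norm_continuant_eq_sum_trajectory hα hf hη]
  rw [Finset.sum_comm]
  have hone : ∀ j : Fin k, M * ((∫ w in Set.Ico (0 : ℝ) 1,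
      Real.log ‖(E + η * Complex.I - trajectory f α j w : ℂ)‖) - ε) -
        (D * T₀ + c + 2 * (a - Real.log η)) ≤
      ∑ m ∈ Finset.range M, Real.log
        ‖(E + η * Complex.I - trajectory f α j (Int.fract (x + m * α + j * α)) : ℂ)‖ := by
    intro j
    have h1 := le_sum_log_norm_of_card_le (E := E) hf.1 hη hη1
      (fun s t hs hst ht => trajectory_add_le (α := α) hf.2.1 hf.2.2.1 j hs hst ht) ha hT₀ hD hc
      (M := M) (fun m => Int.fract (x + j * α + m * α))
      (fun m => ⟨Int.fract_nonneg _, Int.fract_lt_one _⟩) (fun t S => hcard (x + j * α) t S)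
    have h2 : (∫ w in Set.Ico (0 : ℝ) 1,
        Real.log ‖(E + η * Complex.I - trajectory f α j w : ℂ)‖) - ε ≤
        ∫ w in Set.Ico (0 : ℝ) 1,
          min (Real.log ‖(E + η * Complex.I - trajectory f α j w : ℂ)‖) a := by
      have hi := integrableOn_log_norm_sub_trajectory (E := E) (α := α) hf hη hη1 j
      have hi' : IntegrableOn (fun y => max (Real.log (|E| + |f 0| + 4) +
          Real.log (1 + |f y|) - a) 0) (Set.Ico 0 1) :=
        (((integrable_const _).add hf.integrableOn).sub (integrable_const _)).pos_part
      have hi'' : IntegrableOn (fun w =>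
          min (Real.log ‖(E + η * Complex.I - trajectory f α j w : ℂ)‖) a) (Set.Ico 0 1) :=
        Integrable.inf hi (integrable_const a)
      have h3 : (∫ w in Set.Ico (0 : ℝ) 1,
          Real.log ‖(E + η * Complex.I - trajectory f α j w : ℂ)‖) ≤
          ∫ w in Set.Ico (0 : ℝ) 1,
            (min (Real.log ‖(E + η * Complex.I - trajectory f α j w : ℂ)‖) a +
              max (Real.log (|E| + |f 0| + 4) + Real.log (1 + |f w|) - a) 0) := by
        refine setIntegral_mono_on hi (hi''.add hi') measurableSet_Ico fun w hw => ?_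
        have h4 := log_norm_sub_trajectory_le (E := E) (α := α) hf hη hη1 j hw
        rcases le_total (Real.log ‖(E + η * Complex.I - trajectory f α j w : ℂ)‖) a with h5 | h5
        · rw [min_eq_left h5]; linarith [le_max_right
            (Real.log (|E| + |f 0| + 4) + Real.log (1 + |f w|) - a) 0]
        · rw [min_eq_right h5]; linarith [le_max_left
            (Real.log (|E| + |f 0| + 4) + Real.log (1 + |f w|) - a) 0]
      rw [integral_add hi'' hi'] at h3
      linarith
    have h6 : ∀ m : ℕ, x + m * α + j * α = x + j * α + m * α := fun m => by ring
    simp_rw [h6]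
    refine le_trans ?_ h1
    gcongr
  have := Finset.sum_le_sum fun j (_ : j ∈ (Finset.univ : Finset (Fin k))) => hone j
  refine le_trans (le_of_eq ?_) this
  rw [Finset.sum_sub_distrib, ← Finset.mul_sum, Finset.sum_sub_distrib]
  simp only [Finset.sum_const, Finset.card_univ, Fintype.card_fin, nsmul_eq_mul]

end OrbitSums

section Lyapunov

open MeasureTheory

variable {f : ℝ → ℝ} {α γ E η LE : ℝ}

theorem abs_continuant_eq_norm (v : ℕ → ℝ) (k : ℕ) :
    |continuant v k| = ‖continuant (fun i => (v i : ℂ)) k‖ := by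
  have := map_continuant Complex.ofRealHom v k
  simp only [Complex.ofRealHom_eq_coe] at this
  rw [← this, Complex.norm_real, Real.norm_eq_abs]

theorem abs_continuant_sub_le (E η : ℝ) (v : ℕ → ℝ) (k : ℕ) :
    |continuant (fun i => E - v i) k| ≤
      ‖continuant (fun i => (E + η * Complex.I - v i : ℂ)) k‖ := by
  rw [abs_continuant_eq_norm]
  push_cast
  rw [continuant_eq_prod_jacobiEigenvalue, continuant_eq_prod_jacobiEigenvalue, norm_prod,
    norm_prod]
  refine Finset.prod_le_prod (fun _ _ => norm_nonneg _) fun i _ => ?_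
  rw [← Complex.ofReal_sub, Complex.norm_real, Real.norm_eq_abs, abs_sub_comm]
  exact abs_sub_le_norm_add_mul_I_sub _ _ _

theorem det_transferPhi (f : ℝ → ℝ) (α y E : ℝ) (n : ℕ) : (transferPhi f α y E n).det = 1 := by
  induction n with
  | zero => simp [transferPhi]
  | succ n ih => rw [transferPhi, Matrix.det_mul, ih]; simp [transferT, Matrix.det_fin_two]

theorem matNorm_transferPhi_pos (f : ℝ → ℝ) (α y E : ℝ) (n : ℕ) :
    0 < matNorm (transferPhi f α y E n) := by
  refine Real.sqrt_pos.2 ?_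
  have h := det_transferPhi f α y E n
  rw [Matrix.det_fin_two] at h
  simp only [Fin.sum_univ_two]
  set M := transferPhi f α y E n
  nlinarith [sq_nonneg (M 0 0 - M 1 1), sq_nonneg (M 0 1 + M 1 0)]

theorem matNorm_le_of_abs_le {M : Matrix (Fin 2) (Fin 2) ℝ} {B : ℝ} (h : ∀ i j, |M i j| ≤ B) :
    matNorm M ≤ 2 * B := by
  have hB : 0 ≤ B := (abs_nonneg _).trans (h 0 0)
  refine Real.sqrt_le_iff.2 ⟨by positivity, ?_⟩
  have h2 : ∀ i j, M i j ^ 2 ≤ B ^ 2 := fun i j =>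
    sq_le_sq.2 (by rw [abs_of_nonneg hB]; exact h i j)
  simp only [Fin.sum_univ_two]
  nlinarith [h2 0 0, h2 0 1, h2 1 0, h2 1 1]

theorem matNorm_transferPhi_le (f : ℝ → ℝ) (α y E : ℝ) (hη : 0 < η) (hη1 : η ≤ 1) (n : ℕ) :
    matNorm (transferPhi f α y E (n + 2)) ≤ 2 * (‖continuant
      (fun i : ℕ => (E + η * Complex.I - f (y + α + i * α) : ℂ)) (n + 2)‖ / η ^ 2) := by
  set v : ℕ → ℝ := fun i => f (y + α + i * α) with hv
  set V : ℕ → ℂ := fun i => E + η * Complex.I - v i with hV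
  have hVim : ∀ i, η ≤ (V i).im := fun i => by simp [hV]
  have hVim' : ∀ i, η ≤ (V (i + 1)).im := fun i => hVim _
  set P := ‖continuant V (n + 2)‖ with hP
  have hP0 : 0 ≤ P := norm_nonneg _
  have e1 : (fun i : ℕ => E - f (y + (i + 1) * α)) = fun i => E - v i := by
    funext i; simp only [hv]; congr 2; ring
  have e2 : (fun i : ℕ => E - f (y + (i + 2) * α)) = fun i => E - v (i + 1) := by
    funext i; simp only [hv]; congr 2; push_cast; ring
  have b1 : P ≤ P / η ^ 2 := le_div_self hP0 (by positivity) (pow_le_one₀ hη.le hη1)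
  have b2 : ∀ t, η * t ≤ P → t ≤ P / η ^ 2 := by
    intro t ht
    rw [le_div_iff₀ (by positivity)]
    nlinarith
  have h00 : |continuant (fun i => E - v i) (n + 2)| ≤ P := abs_continuant_sub_le E η v _
  have h10 : |continuant (fun i => E - v i) (n + 1)| ≤ P / η ^ 2 := by
    refine (abs_continuant_sub_le E η v _).trans (b2 _ ?_)
    exact mul_norm_continuant_le_succ hη.le hVim (n + 1)
  have h01' : η * ‖continuant (fun i => V (i + 1)) (n + 1)‖ ≤ P :=
    mul_norm_continuant_tail_le hη.le hVim (n + 1)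
  have h01 : |continuant (fun i => E - v (i + 1)) (n + 1)| ≤ P / η ^ 2 :=
    (abs_continuant_sub_le E η (fun i => v (i + 1)) _).trans (b2 _ h01')
  have h11 : |continuant (fun i => E - v (i + 1)) n| ≤ P / η ^ 2 := by
    refine (abs_continuant_sub_le E η (fun i => v (i + 1)) _).trans ?_
    have h := mul_norm_continuant_le_succ hη.le hVim' n
    rw [le_div_iff₀ (by positivity)]
    simp only [hV] at h h01' ⊢
    nlinarith
  refine matNorm_le_of_abs_le fun i j => ?_
  rw [transferPhi_eq_continuant, e1, e2]
  fin_cases i <;> fin_cases j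
  · exact h00.trans b1
  · simpa using h01
  · simpa using h10
  · simpa using h11

theorem exists_le_integral_log_norm_continuant (hα : Irrational α) (hf : MonotonePotential f γ)
    (hL : LyapunovAt f α E LE) {ε : ℝ} (hε : 0 < ε) (hεL : ε < LE) :
    ∃ k₀ : ℕ, ∀ k ≥ k₀, ∀ η : ℝ, 0 < η → η ≤ 1 →
      k * (LE - ε) + 2 * Real.log η - Real.log 2 ≤ ∫ y in (0 : ℝ)..1, Real.log
        ‖continuant (fun i : ℕ => (E + η * Complex.I - f (y + α + i * α) : ℂ)) k‖ := by
  have h1 : ∀ᶠ k : ℕ in atTop, LE - ε < (1 / (k : ℝ)) * ∫ y in (0 : ℝ)..1,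
      Real.log (matNorm (transferPhi f α y E k)) := hL.eventually (lt_mem_nhds (by linarith))
  obtain ⟨k₀, hk₀⟩ := eventually_atTop.1 (h1.and (eventually_ge_atTop 2))
  refine ⟨k₀, fun k hk η hη hη1 => ?_⟩
  obtain ⟨h2, hk2⟩ := hk₀ k hk
  have hkpos : (0 : ℝ) < k := by exact_mod_cast (by omega : 0 < k)
  obtain ⟨n, rfl⟩ : ∃ n, k = n + 2 := ⟨k - 2, by omega⟩
  have h3 : ((n + 2 : ℕ) : ℝ) * (LE - ε) ≤ ∫ y in (0 : ℝ)..1,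
      Real.log (matNorm (transferPhi f α y E (n + 2))) := by
    rw [one_div, inv_mul_eq_div, lt_div_iff₀ hkpos] at h2
    linarith
  have hInt : IntervalIntegrable (fun y => Real.log (matNorm (transferPhi f α y E (n + 2))))
      volume 0 1 := by
    by_contra hcon
    rw [intervalIntegral.integral_undef hcon] at h3
    have : 0 < ((n + 2 : ℕ) : ℝ) * (LE - ε) := mul_pos hkpos (by linarith)
    linarith
  have hInt' := intervalIntegrable_log_norm_continuant (E := E) hα hf hη hη1 (n + 2) α
  have hle : ∀ y, Real.log (matNorm (transferPhi f α y E (n + 2))) ≤ Real.log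
      ‖continuant (fun i : ℕ => (E + η * Complex.I - f (y + α + i * α) : ℂ)) (n + 2)‖ +
        (Real.log 2 - 2 * Real.log η) := by
    intro y
    have hpos := matNorm_transferPhi_pos f α y E (n + 2)
    have h4 := matNorm_transferPhi_le f α y E hη hη1 n
    set P := ‖continuant (fun i : ℕ => (E + η * Complex.I - f (y + α + i * α) : ℂ)) (n + 2)‖
    have hP : 0 < P := by
      by_contra hcon
      have : P = 0 := le_antisymm (not_lt.1 hcon) (norm_nonneg _)
      rw [this] at h4
      simp at h4
      linarith
    refine (Real.log_le_log hpos h4).trans (le_of_eq ?_)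
    rw [Real.log_mul (by norm_num) (by positivity), Real.log_div hP.ne' (by positivity),
      Real.log_pow]
    push_cast; ring
  have h5 := intervalIntegral.integral_mono zero_le_one hInt
    (hInt'.add intervalIntegrable_const) hle
  rw [intervalIntegral.integral_add hInt' intervalIntegrable_const] at h5
  simp only [intervalIntegral.integral_const, sub_zero, smul_eq_mul, one_mul] at h5
  linarith

end Lyapunov

section LargeContinuants

open MeasureTheory

variable {f : ℝ → ℝ} {α γ E LE : ℝ}

theorem norm_continuant_add_mul_I_le {v : ℕ → ℝ} {k : ℕ} (hk : 0 < k) {B : ℝ} (hB1 : 1 ≤ B)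
    (hB : ∀ i m, i + m ≤ k → |continuant (fun j => E - v (i + j)) m| ≤ B) :
    ‖continuant (fun i => (E + (1 / (k * B) : ℝ) * Complex.I - v i : ℂ)) k‖ ≤
      B * Real.exp 1 := by
  have hk0 : (0 : ℝ) < k := by exact_mod_cast hk
  have hB0 : 0 < B := by linarith
  have h := norm_continuant_add_const_le (fun i => ((E - v i : ℝ) : ℂ))
    ((1 / (k * B) : ℝ) * Complex.I) B k (fun i m him => by
      rw [← abs_continuant_eq_norm]; exact hB i m him)
  have hnorm : ‖(((1 / (k * B) : ℝ) : ℂ) * Complex.I)‖ = 1 / (k * B) := by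
    rw [norm_mul, Complex.norm_I, mul_one, Complex.norm_real, Real.norm_eq_abs,
      abs_of_pos (by positivity)]
  rw [hnorm] at h
  have e : (fun i => ((E - v i : ℝ) : ℂ) + ((1 / (k * B) : ℝ) : ℂ) * Complex.I) =
      fun i => (E + (1 / (k * B) : ℝ) * Complex.I - v i : ℂ) := by
    funext i; push_cast; ring
  rw [e] at h
  refine h.trans ?_
  gcongr
  calc (1 + 1 / (k * B) * B) ^ k ≤ (Real.exp (1 / k)) ^ k := by
        gcongr
        have : 1 / (k * B) * B = 1 / (k : ℝ) := by field_simp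
        rw [this, add_comm]
        exact Real.add_one_le_exp _
    _ = Real.exp 1 := by rw [← Real.exp_nat_mul]; congr 1; field_simp

/-- If all continuants on subintervals of `[0, M + k)` are at most `B`, then `log B` dominates
the Lyapunov growth up to the discrepancy of the orbit. -/
theorem exists_lyapunov_le_of_continuant_le (hα : Irrational α) (hf : MonotonePotential f γ)
    (hL : LyapunovAt f α E LE) {ε : ℝ} (hε : 0 < ε) (hεL : ε < LE) (a₀ : ℝ) :
    ∃ a, a₀ ≤ a ∧ 0 ≤ a ∧ ∃ k₀ : ℕ, ∀ k ≥ k₀, ∀ (x T₀ D c B : ℝ) (M : ℕ), 0 ≤ T₀ → 0 ≤ D → 0 ≤ c →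
      (∀ (y t : ℝ) (S : Set ℝ) [DecidablePred (· ∈ S)], S.OrdConnected →
        S ⊆ Set.Ico 0 1 → volume.real S ≤ 2 * Real.exp (a - t) / γ →
        (((Finset.range M).filter fun m : ℕ => Int.fract (y + m * α) ∈ S).card : ℝ) ≤
          M * volume.real S + (if t ≤ T₀ then D else c * Real.exp (T₀ - t)) + 2) →
      1 ≤ B →
      (∀ i m : ℕ, i + m ≤ M + k →
        |continuant (fun j : ℕ => E - f (x + i * α + j * α)) m| ≤ B) →
      M * (k * (LE - 2 * ε)) ≤ M * (3 * Real.log B + 2 * Real.log k + 2) +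
        k * (D * T₀ + c + 2 * (a + Real.log k + Real.log B)) := by
  obtain ⟨a, ha, htail⟩ := exists_integral_max_sub_le (μ := volume.restrict (Set.Ico (0 : ℝ) 1))
    (H := fun y => Real.log (|E| + |f 0| + 4) + Real.log (1 + |f y|))
    ((integrable_const _).add hf.integrableOn) hε (max a₀ 0)
  obtain ⟨k₀, hk₀⟩ := exists_le_integral_log_norm_continuant hα hf hL hε hεL
  refine ⟨a, (le_max_left _ _).trans ha, (le_max_right _ _).trans ha, k₀ + 1,
    fun k hk x T₀ D c B M hT₀ hD hc hcard hB1 hB => ?_⟩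
  have hk0 : 0 < k := by omega
  have hkR : (1 : ℝ) ≤ k := by exact_mod_cast hk0
  have hB0 : 0 < B := by linarith
  have hη : 0 < 1 / (k * B) := by positivity
  have hη1 : 1 / (k * B) ≤ 1 := by
    rw [div_le_one (by positivity)]; nlinarith
  have h1 := hk₀ k (by omega) _ hη hη1
  have h2 := le_sum_log_norm_continuant (E := E) hα hf hη hη1 k x ((le_max_right _ _).trans ha)
    htail hT₀ hD hc hcard
  have hlog : Real.log (1 / (k * B)) = -(Real.log k + Real.log B) := by
    rw [one_div, Real.log_inv, Real.log_mul (by positivity) (by positivity)]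
  rw [hlog] at h1 h2
  have h3 : ∀ m ∈ Finset.range M, Real.log ‖continuant (fun i : ℕ =>
      (E + (1 / (k * B) : ℝ) * Complex.I - f (x + m * α + i * α) : ℂ)) k‖ ≤ Real.log B + 1 := by
    intro m hm
    have hb := norm_continuant_add_mul_I_le (E := E)
      (v := fun i : ℕ => f (x + m * α + i * α)) hk0 hB1
      (fun i n hin => by
        have := hB (m + i) n (by have := Finset.mem_range.1 hm; omega)
        have e : ∀ j : ℕ, x + m * α + ((i + j : ℕ) : ℝ) * α =
          x + ((m + i : ℕ) : ℝ) * α + j * α := fun j => by push_cast; ring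
        simp_rw [e]
        exact this)
    rcases (norm_nonneg (continuant (fun i : ℕ =>
      (E + (1 / (k * B) : ℝ) * Complex.I - f (x + m * α + i * α) : ℂ)) k)).eq_or_lt with h0 | h0
    · rw [← h0, Real.log_zero]
      linarith [Real.log_nonneg hB1]
    · refine (Real.log_le_log h0 hb).trans (le_of_eq ?_)
      rw [Real.log_mul hB0.ne' (Real.exp_pos 1).ne', Real.log_exp]
  have h4 := Finset.sum_le_sum h3
  rw [Finset.sum_const, Finset.card_range, nsmul_eq_mul] at h4
  have hlog2 : Real.log 2 ≤ 1 := by linarith [Real.log_two_lt_d9]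
  have hM : (0 : ℝ) ≤ M := by positivity
  have h5 : M * (k * (LE - ε) + 2 * -(Real.log k + Real.log B) - 1 - k * ε) ≤
      M * ((∫ y in (0 : ℝ)..1, Real.log ‖continuant (fun i : ℕ =>
        (E + (1 / (k * B) : ℝ) * Complex.I - f (y + α + i * α) : ℂ)) k‖) - k * ε) := by
    gcongr; linarith
  linarith

end LargeContinuants

section WindowBounds

open MeasureTheory

variable {f : ℝ → ℝ} {γ α E LE : ℝ} {q : ℕ → ℕ}

theorem eventually_mul_log_add_lt (A B : ℝ) {c : ℝ} (hc : 0 < c) :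
    ∀ᶠ N : ℕ in atTop, A * Real.log N + B < c * N := by
  have h1 : (fun y : ℝ => A * Real.log y + B) =o[atTop] (id : ℝ → ℝ) :=
    (Real.isLittleO_log_id_atTop.const_mul_left A).add
      (Asymptotics.isLittleO_const_id_atTop B)
  have h2 := (h1.comp_tendsto tendsto_natCast_atTop_atTop).def (half_pos hc)
  filter_upwards [h2, eventually_gt_atTop 0] with N hN hN0
  have hN0' : (0 : ℝ) < N := by exact_mod_cast hN0
  simp only [Function.comp_apply, id, Real.norm_eq_abs, Nat.abs_cast] at hN
  have := (le_abs_self _).trans hN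
  nlinarith

/-- In every window of length `O(qₙ)` there is a continuant of exponential size with any rate
below half of the Lyapunov exponent. -/
theorem exists_continuant_gt (hα : Irrational α) (hq : IsCFDenomSeq α q)
    (hf : MonotonePotential f γ) (hL : LyapunovAt f α E LE) {r : ℝ} (hr : 0 < r)
    (hrL : 2 * r < LE) :
    ∃ K : ℕ, 0 < K ∧ ∀ᶠ n in atTop, ∀ x : ℝ, ∃ i m : ℕ, i + m ≤ (K + 1) * q n ∧
      Real.exp (r * q n) < |continuant (fun j : ℕ => E - f (x + i * α + j * α)) m| := by
  set ε := (LE - 2 * r) / 8 with hε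
  have hε0 : 0 < ε := by rw [hε]; linarith
  obtain ⟨a, -, ha, k₀, hk₀⟩ := exists_lyapunov_le_of_continuant_le hα hf hL hε0
    (by rw [hε]; linarith) 0
  obtain ⟨K, hK⟩ := exists_nat_gt (3 * r / ε)
  have hK0 : (0 : ℝ) < K := lt_trans (by positivity) hK
  rw [div_lt_iff₀ hε0] at hK
  have hK0' : 0 < K := by exact_mod_cast hK0
  refine ⟨K, hK0', ?_⟩
  have hev := eventually_mul_log_add_lt (2 + 2 * K)
    ((2 + 2 * K) * Real.log K + 2 + 2 * K * a) (show 0 < ε * K by positivity)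
  filter_upwards [(hq.tendsto hα).eventually hev,
    (hq.tendsto hα).eventually (eventually_ge_atTop k₀)] with n hn hnk x
  by_contra! hcon
  have hN := hq.pos hα n
  have hNR : (0 : ℝ) < q n := by exact_mod_cast hN
  have key := hk₀ (K * q n) (hnk.trans (Nat.le_mul_of_pos_left _ hK0')) x 0 0 0
    (Real.exp (r * q n)) (q n) le_rfl le_rfl le_rfl
    (fun y t S _ hS hS1 _ => by
      obtain ⟨p, hp, hd⟩ := hq.exists_isCoprime hα n
      have h := card_orbit_le hN hp hd y hS hS1
      have hmono : (q n : ℝ) ≤ q (n + 1) := by exact_mod_cast hq.monotone n.le_succ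
      have h1 : (q n : ℝ) * (1 / q (n + 1)) ≤ 1 := by
        rw [mul_one_div, div_le_one (hNR.trans_le hmono)]; exact hmono
      have h0 : (0 : ℝ) ≤ if t ≤ 0 then 0 else 0 * Real.exp (0 - t) := by split_ifs <;> simp
      linarith)
    (Real.one_le_exp (by positivity))
    (fun i m him => hcon i m (by rw [add_mul, one_mul]; omega))
  push_cast at key
  rw [Real.log_mul hK0.ne' hNR.ne', Real.log_exp] at key
  have key2 : K * q n * (LE - 2 * ε) ≤ 3 * (r * q n) + 2 * (Real.log K + Real.log (q n)) + 2 +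
      K * (2 * (a + (Real.log K + Real.log (q n)) + r * q n)) := by
    refine le_of_mul_le_mul_left ?_ hNR
    linarith
  have hLE : LE - 2 * ε = 2 * r + 6 * ε := by rw [hε]; ring
  rw [hLE] at key2
  have h3 : 3 * r * q n ≤ K * ε * q n := by gcongr
  have h4 : (0 : ℝ) < K * ε * q n := by positivity
  nlinarith

/-- In windows long enough to exhaust the resonance at scale `qₙ` there are continuants of
exponential size with an arbitrary rate. -/
theorem exists_continuant_gt_of_resonant (hα : Irrational α) (hq : IsCFDenomSeq α q)
    (hf : MonotonePotential f γ) (hL : LyapunovAt f α E LE) {C ξ : ℝ} (hC : 0 < C) (hξ : 0 < ξ)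
    (hξL : ξ < LE) :
    ∃ K : ℕ, 0 < K ∧ ∀ᶠ n in atTop, ∀ Λ : ℕ, 2 * K ≤ Λ → Λ * q n ≤ q (n + 1) →
      Real.log (q (n + 1) / Λ) ≤ (LE - ξ) * q n → ∀ x : ℝ, ∃ i m : ℕ,
      i + m ≤ Λ * q n + K * q n ∧
      Real.exp (C * q n) < |continuant (fun j : ℕ => E - f (x + i * α + j * α)) m| := by
  set ε := ξ / 4 with hε
  have hε0 : 0 < ε := by positivity
  have hγ : 0 < γ := hf.1
  obtain ⟨a, haγ, ha, k₀, hk₀⟩ := exists_lyapunov_le_of_continuant_le hα hf hL hε0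
    (by rw [hε]; linarith) (Real.log (γ / 2))
  obtain ⟨K, hK⟩ := exists_nat_gt (16 * C / ξ)
  have hK0 : (0 : ℝ) < K := lt_trans (by positivity) hK
  rw [div_lt_iff₀ hξ] at hK
  have hK0' : 0 < K := by exact_mod_cast hK0
  refine ⟨K, hK0', ?_⟩
  have hev := eventually_mul_log_add_lt 3
    (3 * Real.log K + 2 + K + K * (a - Real.log (γ / 2)) + a) (show 0 < K * ξ / 4 by positivity)
  filter_upwards [(hq.tendsto hα).eventually hev,
    (hq.tendsto hα).eventually (eventually_ge_atTop k₀)] with n hn hnk Λ hΛK hΛQ hlog x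
  by_contra! hcon
  have hN := hq.pos hα n
  have hQ := hq.pos hα (n + 1)
  have hΛ : 0 < Λ := by omega
  have hNR : (0 : ℝ) < q n := by exact_mod_cast hN
  have hQR : (0 : ℝ) < q (n + 1) := by exact_mod_cast hQ
  have hΛR : (0 : ℝ) < Λ := by exact_mod_cast hΛ
  have hΛK' : 2 * (K : ℝ) ≤ Λ := by exact_mod_cast hΛK
  have hΛQ' : (Λ : ℝ) * q n ≤ q (n + 1) := by exact_mod_cast hΛQ
  have hQΛ : (1 : ℝ) ≤ q (n + 1) / Λ := by
    rw [one_le_div hΛR]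
    have : Λ ≤ q (n + 1) := (Nat.le_mul_of_pos_right _ hN).trans hΛQ
    exact_mod_cast this
  set T₀ := a - Real.log (γ / 2) + Real.log (q (n + 1) / Λ) with hT₀
  have hT₀0 : 0 ≤ T₀ := by
    have := Real.log_nonneg hQΛ
    rw [hT₀]; linarith
  have hexp : ∀ t, Λ * Real.exp (T₀ - t) = q (n + 1) * (2 * Real.exp (a - t) / γ) := by
    intro t
    rw [show T₀ - t = (a - t) + Real.log (q (n + 1) / Λ) - Real.log (γ / 2) by rw [hT₀]; ring,
      Real.exp_sub, Real.exp_add, Real.exp_log (by positivity), Real.exp_log (by positivity)]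
    field_simp
  have key := hk₀ (K * q n) (hnk.trans (Nat.le_mul_of_pos_left _ hK0')) x T₀ Λ Λ
    (Real.exp (C * q n)) (Λ * q n) hT₀0 hΛR.le hΛR.le
    (fun y t S _ hS hS1 hvol => by
      split_ifs with ht
      · obtain ⟨p, hp, hd⟩ := hq.exists_isCoprime hα n
        have h := card_orbit_mul_le hN hp hd y hS hS1 Λ
        have h1 : (Λ : ℝ) * (q n * (1 / q (n + 1))) ≤ 1 := by
          rw [← mul_assoc, mul_one_div, div_le_one hQR]; exact hΛQ'
        linarith
      · obtain ⟨p, hp, hd⟩ := hq.exists_isCoprime hα (n + 1)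
        have h := card_orbit_le hQ hp hd y hS hS1
        have hmono : (q (n + 1) : ℝ) ≤ q (n + 1 + 1) := by
          exact_mod_cast hq.monotone (Nat.le_succ _)
        have h1 : (q (n + 1) : ℝ) * (1 / q (n + 1 + 1)) ≤ 1 := by
          rw [mul_one_div, div_le_one (hQR.trans_le hmono)]; exact hmono
        have h2 : (((Finset.range (Λ * q n)).filter fun m : ℕ =>
            Int.fract (y + m * α) ∈ S).card : ℝ) ≤ ((Finset.range (q (n + 1))).filter fun m : ℕ =>
            Int.fract (y + m * α) ∈ S).card := by
          exact_mod_cast Finset.card_le_card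
            (Finset.filter_subset_filter _ (Finset.range_subset_range.2 hΛQ))
        have h3 := mul_le_mul_of_nonneg_left hvol hQR.le
        rw [← hexp] at h3
        have h4 : 0 ≤ ((Λ * q n : ℕ) : ℝ) * volume.real S := by positivity
        linarith)
    (Real.one_le_exp (by positivity))
    (fun i m him => hcon i m him)
  push_cast at key
  rw [Real.log_mul hK0.ne' hNR.ne', Real.log_exp] at key
  set X := a + (Real.log K + Real.log (q n)) + C * q n with hX
  have hX0 : 0 ≤ X := by
    have h1 : 0 ≤ Real.log K := Real.log_natCast_nonneg K
    have h2 : 0 ≤ Real.log (q n) := Real.log_natCast_nonneg (q n)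
    positivity
  have key2 : K * q n * (LE - 2 * ε) ≤ 3 * (C * q n) + 2 * (Real.log K + Real.log (q n)) + 2 +
      K * (T₀ + 1) + X := by
    refine le_of_mul_le_mul_left ?_ (mul_pos hΛR hNR)
    have := mul_le_mul_of_nonneg_right hΛK' (mul_nonneg hNR.le hX0)
    linarith
  have hT : K * T₀ ≤ K * (a - Real.log (γ / 2) + (LE - ξ) * q n) := by
    gcongr; rw [hT₀]; linarith
  have h3 : 16 * C * q n ≤ K * ξ * q n := by gcongr
  rw [hε] at key2
  nlinarith

end WindowBounds

section Solutions

variable {V : ℤ → ℝ} {E : ℝ}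

theorem solFun_natCast (V : ℤ → ℝ) (E a b : ℝ) (n : ℕ) :
    solFun V E a b n = (solSeqPos V E a b n).1 := by
  simp [solFun]

theorem solFun_neg_natCast (V : ℤ → ℝ) (E a b : ℝ) (n : ℕ) :
    solFun V E a b (-n) = (solSeqNeg V E a b n).1 := by
  rcases Nat.eq_zero_or_pos n with rfl | hn
  · simp [solFun, solSeqPos, solSeqNeg]
  · rw [solFun, if_neg (by omega)]; simp

theorem isSolution_solFun (V : ℤ → ℝ) (E a b : ℝ) : IsSolution V E (solFun V E a b) := by
  intro n
  obtain ⟨k, rfl | rfl⟩ := n.eq_nat_or_neg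
  · rcases k with _ | k
    · have h1 := solFun_natCast V E a b 1
      have h0 := solFun_natCast V E a b 0
      have hn := solFun_neg_natCast V E a b 1
      simp only [Nat.cast_one, Nat.cast_zero, solSeqPos, solSeqNeg, neg_zero] at h1 h0 hn
      simp only [Nat.cast_zero, zero_add, zero_sub, h1, h0, hn]
      ring
    · have h2 := solFun_natCast V E a b (k + 2)
      have h1 := solFun_natCast V E a b (k + 1)
      have h0 := solFun_natCast V E a b k
      simp only [solSeqPos] at h2 h1
      rw [show ((k + 1 : ℕ) : ℤ) + 1 = (k + 2 : ℕ) by push_cast; ring,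
        show ((k + 1 : ℕ) : ℤ) - 1 = k by push_cast; ring, h2, h1, h0]
      push_cast
      ring
  · rcases k with _ | k
    · have h1 := solFun_natCast V E a b 1
      have h0 := solFun_natCast V E a b 0
      have hn := solFun_neg_natCast V E a b 1
      simp only [Nat.cast_one, Nat.cast_zero, solSeqPos, solSeqNeg, neg_zero] at h1 h0 hn
      simp only [Nat.cast_zero, neg_zero, zero_add, zero_sub, h1, h0, hn]
      ring
    · have h2 := solFun_neg_natCast V E a b (k + 2)
      have h1 := solFun_neg_natCast V E a b (k + 1)
      have h0 := solFun_neg_natCast V E a b k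
      simp only [solSeqNeg] at h2 h1
      rw [show -((k + 1 : ℕ) : ℤ) + 1 = -(k : ℕ) by push_cast; ring,
        show -((k + 1 : ℕ) : ℤ) - 1 = -((k + 2 : ℕ) : ℤ) by push_cast; ring, h2, h1, h0]
      push_cast
      ring

theorem solSeqPos_eq (V : ℤ → ℝ) (E a b : ℝ) (n : ℕ) :
    solSeqPos V E a b n = a • solSeqPos V E 1 0 n + b • solSeqPos V E 0 1 n := by
  induction n with
  | zero => simp [solSeqPos]
  | succ n ih =>
    simp only [solSeqPos, ih]
    ext <;> simp
    ring

theorem solSeqNeg_eq (V : ℤ → ℝ) (E a b : ℝ) (n : ℕ) :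
    solSeqNeg V E a b n = a • solSeqNeg V E 1 0 n + b • solSeqNeg V E 0 1 n := by
  induction n with
  | zero => simp [solSeqNeg]
  | succ n ih =>
    simp only [solSeqNeg, ih]
    ext <;> simp
    ring

theorem solFun_eq (V : ℤ → ℝ) (E a b : ℝ) (n : ℤ) :
    solFun V E a b n = a * solFun V E 1 0 n + b * solFun V E 0 1 n := by
  obtain ⟨k, rfl | rfl⟩ := n.eq_nat_or_neg
  · simp only [solFun_natCast]; rw [solSeqPos_eq]; simp
  · simp only [solFun_neg_natCast]; rw [solSeqNeg_eq]; simp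

theorem continuous_uTheta (V : ℤ → ℝ) (E : ℝ) (n : ℤ) : Continuous fun θ => uTheta V E θ n := by
  simp only [uTheta, solFun_eq V E (-Real.sin _)]
  fun_prop

theorem uTheta_add_pi (V : ℤ → ℝ) (E θ : ℝ) (n : ℤ) : uTheta V E (θ + π) n = -uTheta V E θ n := by
  simp only [uTheta]
  rw [solFun_eq V E (-Real.sin _), solFun_eq V E (-Real.sin θ), Real.sin_add_pi, Real.cos_add_pi]
  ring

/-- The Wronskian of two solutions is constant. -/
theorem IsSolution.wronskian_eq {u v : ℤ → ℝ} (hu : IsSolution V E u) (hv : IsSolution V E v)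
    (n : ℤ) : u (n + 1) * v n - u n * v (n + 1) = u 1 * v 0 - u 0 * v 1 := by
  induction n using Int.induction_on with
  | zero => simp
  | succ n ih =>
    have h1 := hu (n + 1)
    have h2 := hv (n + 1)
    rw [add_sub_cancel_right] at h1 h2
    rw [← ih]
    linear_combination v (n + 1) * h1 - u (n + 1) * h2
  | pred n ih =>
    have h1 := hu (-n)
    have h2 := hv (-n)
    rw [← ih, sub_add_cancel]
    linear_combination -v (-n) * h1 + u (-n) * h2

theorem IsSolution.mul_sub_mul_eq {u v : ℤ → ℝ} (hu : IsSolution V E u) (hv : IsSolution V E v)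
    (i : ℤ) (n : ℕ) :
    u (i + n + 1) * v i - u i * v (i + n + 1) =
      (u 1 * v 0 - u 0 * v 1) * continuant (fun j : ℕ => E - V (i + 1 + j)) n := by
  induction n using Nat.twoStepInduction with
  | zero => simpa [continuant] using hu.wronskian_eq hv i
  | one =>
    have h1 := hu (i + 1)
    have h2 := hv (i + 1)
    rw [add_sub_cancel_right] at h1 h2
    simp only [continuant, Nat.cast_zero, add_zero, Nat.cast_one, ← hu.wronskian_eq hv i]
    linear_combination v i * h1 - u i * h2
  | more n ih₁ ih₂ =>
    have h1 := hu (i + n + 2)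
    have h2 := hv (i + n + 2)
    simp only [continuant]
    push_cast at ih₁ ih₂ ⊢
    rw [show i + (n + 1 : ℤ) + 1 = i + n + 2 by ring] at ih₂
    rw [show i + (n : ℤ) + 2 - 1 = i + n + 1 by ring] at h1 h2
    rw [show i + (n + 2 : ℤ) + 1 = i + n + 2 + 1 by ring,
      show i + 1 + ((n : ℤ) + 1) = i + n + 2 by ring]
    linear_combination v i * h1 - u i * h2 + (E - V (i + n + 2)) * ih₂ - ih₁

theorem sum_Ico_add_mul (g : ℤ → ℝ) (c : ℤ) (m W : ℕ) :
    ∑ n ∈ Finset.Ico c (c + m * W), g n =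
      ∑ b ∈ Finset.range m, ∑ n ∈ Finset.Ico (c + b * W) (c + b * W + W), g n := by
  induction m with
  | zero => simp
  | succ m ih =>
    have hW : (0 : ℤ) ≤ m * W := by positivity
    rw [Finset.sum_range_succ, ← ih, ← Finset.sum_union
      (Finset.disjoint_left.2 fun n h1 h2 => by simp only [Finset.mem_Ico] at h1 h2; omega)]
    congr 1
    ext n
    push_cast
    simp only [Finset.mem_union, Finset.mem_Ico, add_mul, one_mul]
    omega

/-- Large continuants in `m` disjoint windows bound the product of the norms of two solutions
with Wronskian of modulus one. -/
theorem IsSolution.mul_le_sqrt_mul_sqrt {u v : ℤ → ℝ} (hu : IsSolution V E u)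
    (hv : IsSolution V E v) (hW : |u 1 * v 0 - u 0 * v 1| = 1) {B : ℝ} {c : ℤ} {m W : ℕ}
    (h : ∀ b < m, ∃ i n : ℕ, i + n + 2 ≤ W ∧
      B ≤ |continuant (fun j : ℕ => E - V (c + b * W + i + 1 + j)) n|) :
    m * B ≤ √(∑ n ∈ Finset.Ico c (c + m * W), u n ^ 2) *
      √(∑ n ∈ Finset.Ico c (c + m * W), v n ^ 2) := by
  rw [sum_Ico_add_mul, sum_Ico_add_mul]
  refine le_trans ?_ (Real.sum_sqrt_mul_sqrt_le _
    (fun b => Finset.sum_nonneg fun n _ => sq_nonneg _)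
    fun b => Finset.sum_nonneg fun n _ => sq_nonneg _)
  rw [← nsmul_eq_mul]
  refine (congrArg (· • B) (Finset.card_range m)).symm.trans_le
    (Finset.card_nsmul_le_sum (Finset.range m) _ B fun b hb => ?_)
  obtain ⟨i, n, hin, hB⟩ := h b (Finset.mem_range.1 hb)
  set p : ℤ := c + b * W + i with hp
  have hsub : ({p, p + n + 1} : Finset ℤ) ⊆ Finset.Ico (c + b * W) (c + b * W + W) := by
    intro z hz
    simp only [Finset.mem_insert, Finset.mem_singleton] at hz
    rw [Finset.mem_Ico]
    omega
  have hpair : ∀ w : ℤ → ℝ, w p ^ 2 + w (p + n + 1) ^ 2 ≤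
      ∑ n ∈ Finset.Ico (c + b * W) (c + b * W + W), w n ^ 2 := fun w => by
    rw [← Finset.sum_pair (f := fun z => w z ^ 2) (by omega)]
    exact Finset.sum_le_sum_of_subset_of_nonneg hsub fun _ _ _ => sq_nonneg _
  rw [← Real.sqrt_mul (Finset.sum_nonneg fun n _ => sq_nonneg _)]
  refine hB.trans (Real.le_sqrt_of_sq_le ?_)
  have hid := hu.mul_sub_mul_eq hv p n
  have habs : |continuant (fun j : ℕ => E - V (p + 1 + j)) n| =
      |u (p + n + 1) * v p - u p * v (p + n + 1)| := by
    rw [hid, abs_mul, hW, one_mul]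
  rw [habs, sq_abs]
  refine le_trans ?_ (mul_le_mul (hpair u) (hpair v) (by positivity)
    (Finset.sum_nonneg fun n _ => sq_nonneg _))
  nlinarith [sq_nonneg (u p * v p + u (p + n + 1) * v (p + n + 1))]

theorem le_sSup_mul_sInf_image_Ico {g : ℝ → ℝ} {M : ℝ} (hg : Continuous g) (hg0 : ∀ θ, 0 ≤ g θ)
    (hper : ∀ θ, g (θ + π) = g θ) (h : ∀ θ, M ≤ g θ * g (θ + π / 2)) :
    M ≤ sSup (g '' Set.Ico 0 π) * sInf (g '' Set.Ico 0 π) := by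
  have hbdd : BddAbove (g '' Set.Ico 0 π) :=
    (isCompact_Icc.bddAbove_image hg.continuousOn).mono (Set.image_mono Set.Ico_subset_Icc_self)
  set s := sSup (g '' Set.Ico 0 π) with hs
  have hle : ∀ θ ∈ Set.Ico 0 π, g θ ≤ s := fun θ hθ => le_csSup hbdd ⟨θ, hθ, rfl⟩
  have h0 : (0 : ℝ) ∈ Set.Ico 0 π := ⟨le_rfl, Real.pi_pos⟩
  have hs0 : 0 ≤ s := (hg0 0).trans (hle 0 h0)
  have hmul : ∀ θ ∈ Set.Ico 0 π, M ≤ g θ * s := by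
    intro θ hθ
    refine (h θ).trans (mul_le_mul_of_nonneg_left ?_ (hg0 θ))
    rcases lt_or_ge (θ + π / 2) π with hlt | hge
    · exact hle _ ⟨by linarith [hθ.1, Real.pi_pos], hlt⟩
    · rw [show θ + π / 2 = θ - π / 2 + π by ring, hper]
      exact hle _ ⟨by linarith, by linarith [hθ.2, Real.pi_pos]⟩
  rcases hs0.eq_or_lt with h1 | h1
  · rw [← h1, zero_mul]
    simpa [← h1] using hmul 0 h0
  · rw [mul_comm, ← div_le_iff₀ h1]
    refine le_csInf ⟨_, Set.mem_image_of_mem g h0⟩ ?_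
    rintro _ ⟨θ, hθ, rfl⟩
    rw [div_le_iff₀ h1]
    exact hmul θ hθ

theorem mul_le_sqrt_mul_sqrt_uTheta {B : ℝ} {c : ℤ} {m W : ℕ}
    (h : ∀ b < m, ∃ i n : ℕ, i + n + 2 ≤ W ∧
      B ≤ |continuant (fun j : ℕ => E - V (c + b * W + i + 1 + j)) n|) (θ : ℝ) :
    m * B ≤ √(∑ n ∈ Finset.Ico c (c + m * W), uTheta V E θ n ^ 2) *
      √(∑ n ∈ Finset.Ico c (c + m * W), uTheta V E (θ + π / 2) n ^ 2) := by
  refine (isSolution_solFun V E _ _).mul_le_sqrt_mul_sqrt (isSolution_solFun V E _ _) ?_ h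
  have h0 : ∀ a b, solFun V E a b 0 = a := fun a b => by
    simpa [solSeqPos] using solFun_natCast V E a b 0
  have h1 : ∀ a b, solFun V E a b 1 = b := fun a b => by
    simpa [solSeqPos] using solFun_natCast V E a b 1
  simp only [h0, h1, Real.sin_add_pi_div_two, Real.cos_add_pi_div_two]
  rw [show Real.cos θ * -Real.cos θ - -Real.sin θ * -Real.sin θ =
    -(Real.sin θ ^ 2 + Real.cos θ ^ 2) by ring, Real.sin_sq_add_cos_sq]
  simp

theorem le_omegaPlus {B L : ℝ} {m W : ℕ} (hL : m * W ≤ L)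
    (h : ∀ b < m, ∃ i n : ℕ, i + n + 2 ≤ W ∧
      B ≤ |continuant (fun j : ℕ => E - V (1 + b * W + i + 1 + j)) n|) :
    m * B ≤ omegaPlus V E L := by
  have hfl : ((m * W : ℕ) : ℤ) ≤ ⌊L⌋ := Int.le_floor.2 (by exact_mod_cast hL)
  push_cast at hfl
  have hnorm : ∀ u : ℤ → ℝ, √(∑ n ∈ Finset.Ico 1 (1 + (m * W : ℤ)), u n ^ 2) ≤ normPlus u L := by
    refine fun u => Real.sqrt_le_sqrt ?_
    have h1 : ∑ n ∈ Finset.Ico 1 (1 + (m * W : ℤ)), u n ^ 2 ≤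
        ∑ n ∈ Finset.Icc 1 ⌊L⌋, u n ^ 2 :=
      Finset.sum_le_sum_of_subset_of_nonneg (fun n hn => by
        simp only [Finset.mem_Ico, Finset.mem_Icc] at hn ⊢; omega) fun _ _ _ => sq_nonneg _
    have h2 : 0 ≤ (L - ⌊L⌋) * u (⌊L⌋ + 1) ^ 2 :=
      mul_nonneg (sub_nonneg.2 (Int.floor_le L)) (sq_nonneg _)
    linarith
  refine le_sSup_mul_sInf_image_Ico ?_ (fun θ => Real.sqrt_nonneg _) (fun θ => ?_) fun θ =>
    (mul_le_sqrt_mul_sqrt_uTheta h θ).trans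
      (mul_le_mul (hnorm _) (hnorm _) (Real.sqrt_nonneg _) (Real.sqrt_nonneg _))
  · have := continuous_uTheta V E
    unfold normPlus
    fun_prop
  · simp [normPlus, uTheta_add_pi]

theorem le_omegaMinus {B L : ℝ} {m W : ℕ} (hL : m * W ≤ L)
    (h : ∀ b < m, ∃ i n : ℕ, i + n + 2 ≤ W ∧
      B ≤ |continuant (fun j : ℕ => E - V (1 - m * W + b * W + i + 1 + j)) n|) :
    m * B ≤ omegaMinus V E L := by
  have hfl : ((m * W : ℕ) : ℤ) ≤ ⌊L⌋ := Int.le_floor.2 (by exact_mod_cast hL)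
  push_cast at hfl
  have hnorm : ∀ u : ℤ → ℝ, √(∑ n ∈ Finset.Ico (1 - (m * W : ℤ)) (1 - m * W + m * W), u n ^ 2) ≤
      normMinus u L := by
    refine fun u => Real.sqrt_le_sqrt ?_
    have h1 : ∑ n ∈ Finset.Ico (1 - (m * W : ℤ)) (1 - m * W + m * W), u n ^ 2 ≤
        ∑ n ∈ Finset.Icc 0 ⌊L⌋, u (-n) ^ 2 := by
      rw [← Finset.sum_image (f := fun n => u n ^ 2) (g := fun n : ℤ => -n)
        fun a _ b _ hab => neg_injective hab]
      refine Finset.sum_le_sum_of_subset_of_nonneg (fun n hn => ?_) fun _ _ _ => sq_nonneg _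
      rw [Finset.mem_Ico] at hn
      exact Finset.mem_image.2 ⟨-n, Finset.mem_Icc.2 ⟨by omega, by omega⟩, neg_neg n⟩
    have h2 : 0 ≤ (L - ⌊L⌋) * u (-⌊L⌋ - 1) ^ 2 :=
      mul_nonneg (sub_nonneg.2 (Int.floor_le L)) (sq_nonneg _)
    linarith
  refine le_sSup_mul_sInf_image_Ico ?_ (fun θ => Real.sqrt_nonneg _) (fun θ => ?_) fun θ =>
    (mul_le_sqrt_mul_sqrt_uTheta h θ).trans
      (mul_le_mul (hnorm _) (hnorm _) (Real.sqrt_nonneg _) (Real.sqrt_nonneg _))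
  · have := continuous_uTheta V E
    unfold normMinus
    fun_prop
  · simp [normMinus, uTheta_add_pi]

end Solutions

section Growth

variable {f : ℝ → ℝ} {γ α E LE : ℝ} {q : ℕ → ℕ}

theorem eventually_mul_le_exp {A c : ℝ} (hA : 0 < A) (hc : 0 < c) :
    ∀ᶠ N : ℕ in atTop, A * N ≤ Real.exp (c * N) := by
  filter_upwards [eventually_mul_log_add_lt 1 (Real.log A) hc, eventually_gt_atTop 0] with N h hN
  have hN0 : (0 : ℝ) < N := by exact_mod_cast hN
  rw [← Real.exp_log (mul_pos hA hN0), Real.log_mul hA.ne' hN0.ne']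
  exact Real.exp_le_exp.2 (by linarith)

/-- Continuants larger than `B` in all windows of length `W`, uniformly in the phase, give lower
bounds for the norm products in both directions. -/
theorem le_omega_of_forall_exists_continuant {B L : ℝ} {m W : ℕ}
    (h : ∀ x : ℝ, ∃ i n : ℕ, i + n + 2 ≤ W ∧
      B < |continuant (fun j : ℕ => E - f (x + i * α + j * α)) n|)
    (hL : m * W ≤ L) (x : ℝ) :
    m * B ≤ omegaPlus (fun i : ℤ => f (x + i * α)) E L ∧
      m * B ≤ omegaMinus (fun i : ℤ => f (x + i * α)) E L := by
  have key : ∀ c : ℤ, ∃ i n : ℕ, i + n + 2 ≤ W ∧ B ≤ |continuant (fun j : ℕ =>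
      E - (fun i : ℤ => f (x + i * α)) (c + i + 1 + j)) n| := by
    intro c
    obtain ⟨i, n, hin, hB⟩ := h (x + (c + 1) * α)
    refine ⟨i, n, hin, hB.le.trans_eq ?_⟩
    congr 3
    funext j
    push_cast
    ring_nf
  exact ⟨le_omegaPlus hL fun b _ => key _, le_omegaMinus hL fun b _ => key _⟩

theorem eventually_mul_exp_le_omega (hα : Irrational α) (hq : IsCFDenomSeq α q)
    (hf : MonotonePotential f γ) (hL : LyapunovAt f α E LE) (hLE : 0 < LE) {r : ℝ}
    (hrL : 2 * r < LE) :
    ∃ C : ℕ, 0 < C ∧ ∀ᶠ n in atTop, ∀ x L : ℝ, C * q n ≤ L →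
      L * Real.exp (r * q n) ≤ omegaPlus (fun i : ℤ => f (x + i * α)) E L ∧
      L * Real.exp (r * q n) ≤ omegaMinus (fun i : ℤ => f (x + i * α)) E L := by
  obtain ⟨r', hr', hr'L⟩ := exists_between (show max r 0 < LE / 2 from
    max_lt (by linarith) (by linarith))
  have hr'r := (le_max_left _ _).trans_lt hr'
  have hr'0 := (le_max_right _ _).trans_lt hr'
  obtain ⟨K, -, hK⟩ := exists_continuant_gt hα hq hf hL hr'0 (by linarith)
  refine ⟨K + 3, by omega, ?_⟩
  filter_upwards [hK, (hq.tendsto hα).eventually (eventually_mul_le_exp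
    (show (0 : ℝ) < 2 * (K + 3) by positivity) (sub_pos.2 hr'r))] with n hn hexp x L hCL
  have hN := hq.pos hα n
  have hNR : (0 : ℝ) < q n := by exact_mod_cast hN
  push_cast at hCL
  set A : ℝ := (K + 3) * q n with hA
  have hA0 : 0 < A := by positivity
  have hm1 : 1 ≤ L / A := (one_le_div hA0).2 hCL
  have hm : (⌊L / A⌋₊ : ℝ) * ((K + 3) * q n : ℕ) ≤ L := by
    have := Nat.floor_le (zero_le_one.trans hm1)
    rw [le_div_iff₀ hA0] at this
    simpa [hA] using this
  have hfl : L / (2 * A) ≤ ⌊L / A⌋₊ := by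
    have h1 : 1 ≤ ⌊L / A⌋₊ := Nat.le_floor (by simpa using hm1)
    have h1' : (1 : ℝ) ≤ ⌊L / A⌋₊ := by exact_mod_cast h1
    have h2 := Nat.lt_floor_add_one (L / A)
    rw [mul_comm, ← div_div]
    linarith
  have hfin : L * Real.exp (r * q n) ≤ ⌊L / A⌋₊ * Real.exp (r' * q n) := by
    calc L * Real.exp (r * q n) = L / (2 * A) * (2 * (K + 3) * q n) * Real.exp (r * q n) := by
          rw [hA]; field_simp
      _ ≤ L / (2 * A) * Real.exp ((r' - r) * q n) * Real.exp (r * q n) := by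
          have : 0 ≤ L / (2 * A) := div_nonneg (hA0.le.trans hCL) (by positivity)
          gcongr
      _ = L / (2 * A) * Real.exp (r' * q n) := by
          rw [mul_assoc, ← Real.exp_add]; ring_nf
      _ ≤ _ := by gcongr
  have := le_omega_of_forall_exists_continuant (B := Real.exp (r' * q n)) (W := (K + 3) * q n)
    (fun x => by
      obtain ⟨i, m, him, hB⟩ := hn x
      exact ⟨i, m, by nlinarith, hB⟩) hm x
  exact ⟨hfin.trans this.1, hfin.trans this.2⟩

theorem eventually_exp_le_omega_of_resonant (hα : Irrational α) (hq : IsCFDenomSeq α q)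
    (hf : MonotonePotential f γ) (hL : LyapunovAt f α E LE) (hLE : 0 < LE) {b τ c : ℝ}
    (hb : ∀ᶠ n in atTop, Real.log (q (n + 1)) ≤ b * q n) (hτ : 0 < τ) (hbτ : b - LE < τ)
    (hc : 0 < c) {C : ℕ} (hC : 0 < C) :
    ∀ᶠ n in atTop, ∀ x L : ℝ, Real.exp (τ * q n) ≤ L → L ≤ C * q (n + 1) →
      Real.exp (c * q n) ≤ omegaPlus (fun i : ℤ => f (x + i * α)) E L ∧
      Real.exp (c * q n) ≤ omegaMinus (fun i : ℤ => f (x + i * α)) E L := by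
  obtain ⟨τ', hτ', hτ'τ⟩ := exists_between (max_lt hbτ hτ)
  have hτ'b := (le_max_left _ _).trans_lt hτ'
  have hτ'0 := (le_max_right _ _).trans_lt hτ'
  obtain ⟨ξ, hξ, hξ'⟩ := exists_between (lt_min (sub_pos.2 hτ'b) hLE)
  have hξb := hξ'.trans_le (min_le_left _ _)
  have hξL := hξ'.trans_le (min_le_right _ _)
  obtain ⟨K, hK0, hK⟩ := exists_continuant_gt_of_resonant hα hq hf hL hc hξ hξL
  have hCR : (0 : ℝ) < C := by exact_mod_cast hC
  filter_upwards [hb, hK,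
    (hq.tendsto hα).eventually (eventually_mul_log_add_lt 0 (Real.log 2) (sub_pos.2 hξb)),
    (hq.tendsto hα).eventually (eventually_mul_le_exp
      (show (0 : ℝ) < 2 * K + 1 by positivity) hτ'0),
    (hq.tendsto hα).eventually (eventually_mul_le_exp
      (show (0 : ℝ) < C + K + 3 by positivity) (sub_pos.2 hτ'τ))]
    with n hbn hn hlog hK' hC' x L hτL hLC
  have hN := hq.pos hα n
  have hNR : (1 : ℝ) ≤ q n := by exact_mod_cast hN
  have hQR : (0 : ℝ) < q (n + 1) := by exact_mod_cast hq.pos hα (n + 1)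
  set X := Real.exp (τ' * q n) with hX
  have hXτ : (C + K + 3) * q n * X ≤ Real.exp (τ * q n) := by
    refine (mul_le_mul_of_nonneg_right hC' (Real.exp_pos _).le).trans_eq ?_
    rw [← Real.exp_add]; ring_nf
  have hX1 : 1 ≤ X := Real.one_le_exp (by positivity)
  set Λ := ⌊X⌋₊ with hΛ
  have hΛX : (Λ : ℝ) ≤ X := Nat.floor_le (by linarith)
  have hΛ1 : (1 : ℝ) ≤ Λ := by
    have : 1 ≤ Λ := Nat.le_floor (by simpa using hX1)
    exact_mod_cast this
  have hXΛ : X / 2 ≤ Λ := by linarith [Nat.lt_floor_add_one X]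
  have hNX : 0 ≤ q n * X := by positivity
  have h1 : (K : ℝ) * q n ≤ K * q n * X := le_mul_of_one_le_right (by positivity) hX1
  have h2 : (Λ : ℝ) * q n ≤ q n * X := by rw [mul_comm]; gcongr
  have h3 : 0 ≤ C * (q n * X) := by positivity
  have h4 : 0 ≤ K * (q n * X) := by positivity
  have h5 : 1 ≤ q n * X := one_le_mul_of_one_le_of_one_le hNR hX1
  have hΛQ : (Λ : ℝ) * q n ≤ q (n + 1) := by
    refine le_of_mul_le_mul_left ?_ hCR
    have := mul_le_mul_of_nonneg_left h2 hCR.le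
    linarith
  have hlogΛ : Real.log (q (n + 1) / Λ) ≤ (LE - ξ) * q n := by
    have hl : Real.log (X / 2) ≤ Real.log Λ := Real.log_le_log (by linarith) hXΛ
    rw [Real.log_div (by linarith) two_ne_zero, hX, Real.log_exp] at hl
    rw [Real.log_div hQR.ne' (by linarith)]
    nlinarith
  have h2K : 2 * K ≤ Λ := Nat.le_floor (by
    push_cast
    refine le_trans ?_ hK'
    nlinarith [(Nat.cast_nonneg K : (0 : ℝ) ≤ K)])
  have hwin := hn Λ h2K (by exact_mod_cast hΛQ) hlogΛ
  have := le_omega_of_forall_exists_continuant (m := 1) (L := L)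
    (W := Λ * q n + K * q n + 2)
    (fun x => by
      obtain ⟨i, m, him, hB⟩ := hwin x
      exact ⟨i, m, by omega, hB⟩) (by push_cast; linarith) x
  simpa using this

theorem exists_scale (hα : Irrational α) (hq : IsCFDenomSeq α q) {C : ℕ} (hC : 0 < C) {n₀ : ℕ}
    {L : ℝ} (hL : C * q n₀ ≤ L) : ∃ n ≥ n₀, C * q n ≤ L ∧ L ≤ C * q (n + 1) := by
  have hex : ∃ n, L < C * q n := by
    obtain ⟨N, hN⟩ := exists_nat_gt L
    obtain ⟨n, hn⟩ := ((hq.tendsto hα).eventually (eventually_ge_atTop N)).exists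
    have : N ≤ C * q n := hn.trans (Nat.le_mul_of_pos_left _ hC)
    exact ⟨n, hN.trans_le (by exact_mod_cast this)⟩
  classical
  have hlt : n₀ < Nat.find hex := by
    by_contra! hle
    have h1 := Nat.find_spec hex
    have h2 : C * q (Nat.find hex) ≤ C * q n₀ := Nat.mul_le_mul_left _ (hq.monotone hle)
    have h3 : (C : ℝ) * q (Nat.find hex) ≤ C * q n₀ := by exact_mod_cast h2
    linarith
  refine ⟨Nat.find hex - 1, by omega, ?_, ?_⟩
  · simpa using Nat.find_min hex (show Nat.find hex - 1 < Nat.find hex by omega)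
  · rw [show Nat.find hex - 1 + 1 = Nat.find hex by omega]
    exact (Nat.find_spec hex).le

end Growth

/-- Growth of the norm products `ω_±(L)`: for large `L`,
`ω_±(L) ≥ L^{1 + L(E)/(2 t₁ β) - ε}` where `t₁ = (β - L(E))/β + σ`. -/
theorem stmt_12 (f : ℝ → ℝ) (γ α x E LE t₂ σ : ℝ)
    (hα : Irrational α) (q : ℕ → ℕ) (hq : IsCFDenomSeq α q)
    (hβfin : Filter.IsBoundedUnder (· ≤ ·) Filter.atTop
      (fun n : ℕ => Real.log (q (n + 1)) / (q n : ℝ)))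
    (hβpos : 0 < cfBeta q)
    (hf : MonotonePotential f γ)
    (hLyap : LyapunovAt f α E LE) (hLE : 0 < LE)
    (ht₂ : (9 * cfBeta q - LE) / (9 * cfBeta q) < t₂) (ht₂1 : t₂ < 1)
    (hσ : 0 < σ) (ht₁ : (cfBeta q - LE) / cfBeta q + σ < t₂)
    (hgef : ∃ φ : ℤ → ℝ, IsGeneralizedEigenfunction (fun i : ℤ => f (x + i * α)) E φ) :
    ∀ ε : ℝ, 0 < ε → ∃ L₀ : ℝ, 0 < L₀ ∧ ∀ L : ℝ, L₀ ≤ L →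
      L ^ (1 + LE / (2 * ((cfBeta q - LE) / cfBeta q + σ) * cfBeta q) - ε) ≤
          omegaPlus (fun i : ℤ => f (x + i * α)) E L ∧
      L ^ (1 + LE / (2 * ((cfBeta q - LE) / cfBeta q + σ) * cfBeta q) - ε) ≤
          omegaMinus (fun i : ℤ => f (x + i * α)) E L := by
  intro ε hε
  set β := cfBeta q with hβ
  set τ := β - LE + σ * β with hτ
  have hden : 2 * ((β - LE) / β + σ) * β = 2 * τ := by rw [hτ]; field_simp
  rw [hden, add_sub_assoc]
  set P := LE / (2 * τ) - ε with hP
  have hC1 : ∀ C : ℕ, 0 < C → ∀ n, (1 : ℝ) ≤ C * q n := fun C hC n => by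
    have : 1 ≤ C * q n := Nat.mul_pos hC (hq.pos hα n)
    exact_mod_cast this
  rcases le_or_gt P 0 with hP0 | hP0
  · obtain ⟨C, hC, hev⟩ := eventually_mul_exp_le_omega hα hq hf hLyap hLE (r := 0) (by simpa)
    obtain ⟨n, hn⟩ := hev.exists
    refine ⟨C * q n, by linarith [hC1 C hC n], fun L hL => ?_⟩
    have hL1 : 1 ≤ L := (hC1 C hC n).trans hL
    have hle : L ^ (1 + P) ≤ L * Real.exp (0 * q n) := by
      simpa using Real.rpow_le_rpow_of_exponent_le hL1 (show 1 + P ≤ 1 by linarith)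
    exact ⟨hle.trans (hn x L hL).1, hle.trans (hn x L hL).2⟩
  · have hτ0 : 0 < τ := by
      by_contra! h
      have : LE / (2 * τ) ≤ 0 := div_nonpos_of_nonneg_of_nonpos hLE.le (by linarith)
      linarith
    have hτP : 2 * (τ * P) < LE := by
      have : 2 * (τ * P) = LE - 2 * τ * ε := by rw [hP]; field_simp
      have := mul_pos hτ0 hε
      linarith
    obtain ⟨C, hC, hev⟩ := eventually_mul_exp_le_omega hα hq hf hLyap hLE hτP
    have hσβ : 0 < σ * β := mul_pos hσ hβpos
    set b := β + σ * β / 2 with hbdef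
    have hb0 : 0 < b := by positivity
    have hb : ∀ᶠ n in atTop, Real.log (q (n + 1)) ≤ b * q n := by
      filter_upwards [eventually_lt_of_limsup_lt (show cfBeta q < b by rw [← hβ]; linarith)
        hβfin] with n hn
      have hNR : (0 : ℝ) < q n := by exact_mod_cast hq.pos hα n
      exact ((div_lt_iff₀ hNR).1 hn).le
    have hres := eventually_exp_le_omega_of_resonant hα hq hf hLyap hLE hb hτ0
      (by rw [hbdef, hτ]; linarith) (show 0 < b * (1 + P) + 1 by positivity) hC
    have hCev := (hq.tendsto hα).eventually (eventually_mul_log_add_lt 0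
      ((1 + P) * Real.log C) one_pos)
    obtain ⟨n₀, hn₀⟩ := eventually_atTop.1 (hev.and (hres.and (hb.and hCev)))
    refine ⟨C * q n₀, by linarith [hC1 C hC n₀], fun L hL => ?_⟩
    have hL1 : 1 ≤ L := (hC1 C hC n₀).trans hL
    have hL0 : 0 < L := by linarith
    obtain ⟨n, hn, hCn, hCn'⟩ := exists_scale hα hq hC hL
    obtain ⟨h1, h2, h3, h4⟩ := hn₀ n hn
    rcases le_total L (Real.exp (τ * q n)) with hLτ | hLτ
    · have hle : L ^ (1 + P) ≤ L * Real.exp (τ * P * q n) := by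
        rw [Real.rpow_add hL0, Real.rpow_one]
        gcongr
        refine (Real.rpow_le_rpow hL0.le hLτ hP0.le).trans_eq ?_
        rw [← Real.exp_mul]; ring_nf
      exact ⟨hle.trans (h1 x L hCn).1, hle.trans (h1 x L hCn).2⟩
    · have hle : L ^ (1 + P) ≤ Real.exp ((b * (1 + P) + 1) * q n) := by
        have hCR : (0 : ℝ) < C := by exact_mod_cast hC
        have hQR : (0 : ℝ) < q (n + 1) := by exact_mod_cast hq.pos hα (n + 1)
        rw [Real.rpow_def_of_pos hL0]
        refine Real.exp_le_exp.2 ?_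
        have hlogL := Real.log_le_log hL0 hCn'
        rw [Real.log_mul hCR.ne' hQR.ne'] at hlogL
        have : Real.log L * (1 + P) ≤ (Real.log C + b * q n) * (1 + P) := by
          gcongr; linarith
        linarith
      exact ⟨hle.trans (h2 x L hLτ hCn').1, hle.trans (h2 x L hLτ hCn').2⟩
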